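/- arXiv:2312.13166 — 10 statements merged into one kernel-verified Lean document; each statement's English description precedes it below -/
import Mathlib

section
/- A unit-speed continuously differentiable curve γ = (γ₁,γ₂) : [0,L] → ℝ² is static if and only if ∫₀^L γ₁'(t)² dt = ∫₀^L γ₂'(t)² dt = L/2 and ∫₀^L γ₁'(t) γ₂'(t) dt = 0. -/
open MeasureTheory

/-- The unit circle in `ℝ × ℝ`. -/
def circle2 : Set (ℝ × ℝ) := {p | p.1 ^ 2 + p.2 ^ 2 = 1}

/-- A curve with derivative `(g₁, g₂)` on `[0, L]` is *static* if for every probability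
measure `ν` on the unit circle, `∫_{S¹} (∫₀^L ⟨θ, γ'(t)⟩² dt)² dν(θ) = L²/4`. -/
def IsStaticCurve (L : ℝ) (g₁ g₂ : ℝ → ℝ) : Prop :=
  ∀ ν : Measure circle2, IsProbabilityMeasure ν →
    (∫ θ : circle2, (∫ t in (0:ℝ)..L,
        ((θ : ℝ × ℝ).1 * g₁ t + (θ : ℝ × ℝ).2 * g₂ t) ^ 2) ^ 2 ∂ν) = L ^ 2 / 4

/-- The energy of a planar vector field in the direction `(x, y)` is a quadratic form
in `(x, y)`. -/
theorem integral_directional_sq {a b : ℝ} {g₁ g₂ : ℝ → ℝ}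
    (hc1 : ContinuousOn g₁ (Set.uIcc a b)) (hc2 : ContinuousOn g₂ (Set.uIcc a b)) (x y : ℝ) :
    (∫ t in a..b, (x * g₁ t + y * g₂ t) ^ 2) =
      x ^ 2 * (∫ t in a..b, g₁ t ^ 2) + 2 * x * y * (∫ t in a..b, g₁ t * g₂ t) +
        y ^ 2 * (∫ t in a..b, g₂ t ^ 2) := by
  have h1 : IntervalIntegrable (fun t => x ^ 2 * g₁ t ^ 2) volume a b :=
    (continuousOn_const.mul (hc1.pow 2)).intervalIntegrable
  have h2 : IntervalIntegrable (fun t => 2 * x * y * (g₁ t * g₂ t)) volume a b :=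
    (continuousOn_const.mul (hc1.mul hc2)).intervalIntegrable
  have h3 : IntervalIntegrable (fun t => y ^ 2 * g₂ t ^ 2) volume a b :=
    (continuousOn_const.mul (hc2.pow 2)).intervalIntegrable
  rw [← intervalIntegral.integral_const_mul, ← intervalIntegral.integral_const_mul,
    ← intervalIntegral.integral_const_mul, ← intervalIntegral.integral_add h1 h2,
    ← intervalIntegral.integral_add (h1.add h2) h3]
  congr 1
  ext t
  ring

/-- Along a static curve, the energy in every unit direction is half the length. -/
theorem IsStaticCurve.integral_directional_sq_eq {L : ℝ} (hL : 0 ≤ L) {g₁ g₂ : ℝ → ℝ}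
    (h : IsStaticCurve L g₁ g₂) {x y : ℝ} (hxy : x ^ 2 + y ^ 2 = 1) :
    (∫ t in (0:ℝ)..L, (x * g₁ t + y * g₂ t) ^ 2) = L / 2 := by
  have hsq := h (Measure.dirac ⟨(x, y), hxy⟩) inferInstance
  rw [integral_dirac] at hsq
  have hnonneg : 0 ≤ ∫ t in (0:ℝ)..L, (x * g₁ t + y * g₂ t) ^ 2 :=
    intervalIntegral.integral_nonneg hL fun t _ => sq_nonneg _
  refine (sq_eq_sq₀ hnonneg (by positivity)).mp (hsq.trans ?_)
  ring

/-- A unit-speed `C¹` curve is static iff `∫ γ₁'² = ∫ γ₂'² = L/2` and `∫ γ₁' γ₂' = 0`. -/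
theorem static_iff (L : ℝ) (hL : 0 < L) (γ₁ γ₂ g₁ g₂ : ℝ → ℝ)
    (hd1 : ∀ t ∈ Set.Icc (0:ℝ) L, HasDerivAt γ₁ (g₁ t) t)
    (hd2 : ∀ t ∈ Set.Icc (0:ℝ) L, HasDerivAt γ₂ (g₂ t) t)
    (hc1 : ContinuousOn g₁ (Set.Icc 0 L))
    (hc2 : ContinuousOn g₂ (Set.Icc 0 L))
    (hunit : ∀ t ∈ Set.Icc (0:ℝ) L, g₁ t ^ 2 + g₂ t ^ 2 = 1) :
    IsStaticCurve L g₁ g₂ ↔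
      ((∫ t in (0:ℝ)..L, g₁ t ^ 2) = L / 2 ∧ (∫ t in (0:ℝ)..L, g₂ t ^ 2) = L / 2 ∧
        (∫ t in (0:ℝ)..L, g₁ t * g₂ t) = 0) := by
  have hu : Set.uIcc 0 L = Set.Icc 0 L := Set.uIcc_of_le hL.le
  have hq := integral_directional_sq (hu ▸ hc1) (hu ▸ hc2)
  constructor
  · intro h
    have e1 := h.integral_directional_sq_eq hL.le (x := 1) (y := 0) (by norm_num)
    have e2 := h.integral_directional_sq_eq hL.le (x := 0) (y := 1) (by norm_num)
    have e3 := h.integral_directional_sq_eq hL.le (x := 3 / 5) (y := 4 / 5) (by norm_num)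
    rw [hq] at e1 e2 e3
    refine ⟨?_, ?_, ?_⟩ <;> linarith
  · rintro ⟨hA, hB, hC⟩ ν hν
    have hconst : ∀ θ : circle2, (∫ t in (0:ℝ)..L,
        ((θ : ℝ × ℝ).1 * g₁ t + (θ : ℝ × ℝ).2 * g₂ t) ^ 2) ^ 2 = L ^ 2 / 4 := by
      intro θ
      have hθ : (θ : ℝ × ℝ).1 ^ 2 + (θ : ℝ × ℝ).2 ^ 2 = 1 := θ.2
      rw [hq, hA, hB, hC, mul_zero, add_zero, ← add_mul, hθ]
      ring
    simp [hconst]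
end

section
/- Let ν be a probability measure on the unit circle S¹ ⊂ ℝ² ≅ ℂ that is invariant under the maps z ↦ i·z and z ↦ conj(z), and set ν̂(4) := ∫_{S¹} Re(z⁴) dν(z). Then for every unit-speed continuously differentiable curve γ on [0,L], ∫_{S¹} (∫₀^L ⟨θ, γ'(t)⟩² dt)² dν(θ) = (L²/8)(1 + 2 I₂) + (L²/8) ν̂(4) (1 − 2 I₂^⊥), where I₂ := (1/L²)∫₀^L∫₀^L ⟨γ'(t), γ'(u)⟩² dt du and I₂^⊥ := (1/L²)∫₀^L∫₀^L ⟨γ'(t), (γ₂'(u), γ₁'(u))⟩² dt du. -/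
open MeasureTheory

/-- The map `z ↦ i·z` on the unit circle, i.e. `(x, y) ↦ (-y, x)`. -/
def mulI : circle2 → circle2 := fun p =>
  ⟨(-(p : ℝ × ℝ).2, (p : ℝ × ℝ).1), by
    have h := p.2
    simp only [circle2, Set.mem_setOf_eq] at h ⊢
    nlinarith [h]⟩

/-- The map `z ↦ conj z` on the unit circle, i.e. `(x, y) ↦ (x, -y)`. -/
def conjC : circle2 → circle2 := fun p =>
  ⟨((p : ℝ × ℝ).1, -(p : ℝ × ℝ).2), by
    have h := p.2
    simp only [circle2, Set.mem_setOf_eq] at h ⊢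
    nlinarith [h]⟩

theorem isCompact_circle2 : IsCompact circle2 := by
  refine Metric.isCompact_of_isClosed_isBounded
    (isClosed_eq (by fun_prop) continuous_const) ?_
  refine (Metric.isBounded_closedBall (x := (0 : ℝ × ℝ)) (r := 1)).subset fun p hp => ?_
  have hp' : p.1 ^ 2 + p.2 ^ 2 = 1 := hp
  rw [mem_closedBall_zero_iff, Prod.norm_def, max_le_iff, Real.norm_eq_abs, Real.norm_eq_abs]
  constructor <;> refine abs_le_one_iff_mul_self_le_one.mpr ?_ <;>
    nlinarith [sq_nonneg p.1, sq_nonneg p.2]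

theorem integrable_of_continuous_circle2 {ν : Measure circle2} [IsFiniteMeasure ν]
    {f : circle2 → ℝ} (hf : Continuous f) : Integrable f ν := by
  have : CompactSpace circle2 := isCompact_iff_compactSpace.mp isCompact_circle2
  exact hf.integrable_of_hasCompactSupport (HasCompactSupport.of_compactSpace f)

theorem continuous_mulI : Continuous mulI :=
  Continuous.subtype_mk (by fun_prop) _

theorem continuous_conjC : Continuous conjC :=
  Continuous.subtype_mk (by fun_prop) _

theorem integral_comp_eq_of_map_eq {ν : Measure circle2} {T : circle2 → circle2}
    (hT : Continuous T) (hν : ν.map T = ν) {f : circle2 → ℝ} (hf : Continuous f) :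
    ∫ θ, f (T θ) ∂ν = ∫ θ, f θ ∂ν := by
  conv_rhs => rw [← hν]
  exact (integral_map hT.aemeasurable hf.aestronglyMeasurable).symm

theorem integral_snd_pow_four {ν : Measure circle2} (hrot : ν.map mulI = ν) :
    ∫ θ : circle2, (θ : ℝ × ℝ).2 ^ 4 ∂ν = ∫ θ : circle2, (θ : ℝ × ℝ).1 ^ 4 ∂ν := by
  have h := integral_comp_eq_of_map_eq continuous_mulI hrot
    (f := fun θ => (θ : ℝ × ℝ).1 ^ 4) (by fun_prop)
  simpa [mulI, Even.neg_pow (show Even 4 by decide)] using h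

/-- The integral of a squared quadratic form against a measure on the circle with the
symmetries of the square, in terms of its fourth moments. -/
theorem integral_sq_quadratic_form_circle2 {ν : Measure circle2} [IsFiniteMeasure ν]
    (hrot : ν.map mulI = ν) (hconj : ν.map conjC = ν) (A B C : ℝ) :
    ∫ θ : circle2, ((θ : ℝ × ℝ).1 ^ 2 * A + 2 * ((θ : ℝ × ℝ).1 * (θ : ℝ × ℝ).2) * B
        + (θ : ℝ × ℝ).2 ^ 2 * C) ^ 2 ∂ν =
      (A ^ 2 + C ^ 2) * (∫ θ : circle2, (θ : ℝ × ℝ).1 ^ 4 ∂ν) +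
        (4 * B ^ 2 + 2 * A * C) *
          ∫ θ : circle2, (θ : ℝ × ℝ).1 ^ 2 * (θ : ℝ × ℝ).2 ^ 2 ∂ν := by
  have hodd : ∫ θ : circle2, (4 * A * B * ((θ : ℝ × ℝ).1 ^ 3 * (θ : ℝ × ℝ).2)
      + 4 * B * C * ((θ : ℝ × ℝ).1 * (θ : ℝ × ℝ).2 ^ 3)) ∂ν = 0 := by
    have h := integral_comp_eq_of_map_eq continuous_conjC hconj
      (f := fun θ => 4 * A * B * ((θ : ℝ × ℝ).1 ^ 3 * (θ : ℝ × ℝ).2)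
        + 4 * B * C * ((θ : ℝ × ℝ).1 * (θ : ℝ × ℝ).2 ^ 3)) (by fun_prop)
    rw [← self_eq_neg, ← integral_neg, ← h]
    congr 1 with θ
    simp only [conjC]
    ring
  have hexp : ∀ θ : circle2, ((θ : ℝ × ℝ).1 ^ 2 * A
      + 2 * ((θ : ℝ × ℝ).1 * (θ : ℝ × ℝ).2) * B + (θ : ℝ × ℝ).2 ^ 2 * C) ^ 2 =
      A ^ 2 * (θ : ℝ × ℝ).1 ^ 4 + C ^ 2 * (θ : ℝ × ℝ).2 ^ 4
        + (4 * B ^ 2 + 2 * A * C) * ((θ : ℝ × ℝ).1 ^ 2 * (θ : ℝ × ℝ).2 ^ 2)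
        + (4 * A * B * ((θ : ℝ × ℝ).1 ^ 3 * (θ : ℝ × ℝ).2)
          + 4 * B * C * ((θ : ℝ × ℝ).1 * (θ : ℝ × ℝ).2 ^ 3)) := fun θ => by ring
  simp_rw [hexp]
  rw [integral_add (integrable_of_continuous_circle2 (by fun_prop))
      (integrable_of_continuous_circle2 (by fun_prop)), hodd,
    integral_add (integrable_of_continuous_circle2 (by fun_prop))
      (integrable_of_continuous_circle2 (by fun_prop)),
    integral_add (integrable_of_continuous_circle2 (by fun_prop))
      (integrable_of_continuous_circle2 (by fun_prop)),
    integral_const_mul, integral_const_mul, integral_const_mul, integral_snd_pow_four hrot]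
  ring

theorem fourth_moments_circle2 {ν : Measure circle2} [IsProbabilityMeasure ν]
    (hrot : ν.map mulI = ν) :
    2 * (∫ θ : circle2, (θ : ℝ × ℝ).1 ^ 4 ∂ν) +
        2 * (∫ θ : circle2, (θ : ℝ × ℝ).1 ^ 2 * (θ : ℝ × ℝ).2 ^ 2 ∂ν) = 1 ∧
      2 * (∫ θ : circle2, (θ : ℝ × ℝ).1 ^ 4 ∂ν) -
        6 * (∫ θ : circle2, (θ : ℝ × ℝ).1 ^ 2 * (θ : ℝ × ℝ).2 ^ 2 ∂ν) =
      ∫ θ : circle2,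
          (((((θ : ℝ × ℝ).1 : ℂ) + ((θ : ℝ × ℝ).2 : ℂ) * Complex.I) ^ 4).re) ∂ν := by
  have key : ∀ c : ℝ, ∫ θ : circle2, ((θ : ℝ × ℝ).1 ^ 4 + (θ : ℝ × ℝ).2 ^ 4
      + c * ((θ : ℝ × ℝ).1 ^ 2 * (θ : ℝ × ℝ).2 ^ 2)) ∂ν =
      2 * (∫ θ : circle2, (θ : ℝ × ℝ).1 ^ 4 ∂ν) +
        c * (∫ θ : circle2, (θ : ℝ × ℝ).1 ^ 2 * (θ : ℝ × ℝ).2 ^ 2 ∂ν) := fun c => by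
    rw [integral_add (integrable_of_continuous_circle2 (by fun_prop))
        (integrable_of_continuous_circle2 (by fun_prop)),
      integral_add (integrable_of_continuous_circle2 (by fun_prop))
        (integrable_of_continuous_circle2 (by fun_prop)), integral_const_mul, integral_snd_pow_four hrot]
    ring
  constructor
  · rw [← key]
    have hone : ∀ θ : circle2, (θ : ℝ × ℝ).1 ^ 4 + (θ : ℝ × ℝ).2 ^ 4
        + 2 * ((θ : ℝ × ℝ).1 ^ 2 * (θ : ℝ × ℝ).2 ^ 2) = 1 := fun θ => by
      have h : (θ : ℝ × ℝ).1 ^ 2 + (θ : ℝ × ℝ).2 ^ 2 = 1 := θ.2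
      linear_combination ((θ : ℝ × ℝ).1 ^ 2 + (θ : ℝ × ℝ).2 ^ 2 + 1) * h
    simp [hone]
  · rw [sub_eq_add_neg, ← neg_mul, ← key]
    congr 1 with θ
    simp [pow_succ]
    ring

/-- Integration over an interval of a quadratic form with constant coefficients. -/
theorem integral_quadratic_form {L : ℝ} (hL : 0 ≤ L) {g₁ g₂ : ℝ → ℝ}
    (hc1 : ContinuousOn g₁ (Set.Icc 0 L)) (hc2 : ContinuousOn g₂ (Set.Icc 0 L)) (a b c : ℝ) :
    ∫ t in (0 : ℝ)..L, (a * g₁ t ^ 2 + b * (g₁ t * g₂ t) + c * g₂ t ^ 2) =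
      a * (∫ t in (0 : ℝ)..L, g₁ t ^ 2) + b * (∫ t in (0 : ℝ)..L, g₁ t * g₂ t)
        + c * ∫ t in (0 : ℝ)..L, g₂ t ^ 2 := by
  rw [← Set.uIcc_of_le hL] at hc1 hc2
  have h1 : IntervalIntegrable (fun t => g₁ t ^ 2) volume 0 L := (hc1.pow 2).intervalIntegrable
  have h12 : IntervalIntegrable (fun t => g₁ t * g₂ t) volume 0 L :=
    (hc1.mul hc2).intervalIntegrable
  have h2 : IntervalIntegrable (fun t => g₂ t ^ 2) volume 0 L := (hc2.pow 2).intervalIntegrable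
  rw [intervalIntegral.integral_add ((h1.const_mul a).add (h12.const_mul b)) (h2.const_mul c),
    intervalIntegral.integral_add (h1.const_mul a) (h12.const_mul b)]
  simp only [intervalIntegral.integral_const_mul]

/-- For a probability measure `ν` on the unit circle invariant under `z ↦ i·z` and
`z ↦ conj z`, with `ν̂(4) = ∫ Re(z⁴) dν(z)`, and any unit-speed `C¹` curve on `[0, L]`,
`∫_{S¹} (∫₀^L ⟨θ, γ'(t)⟩² dt)² dν(θ) = (L²/8)(1 + 2 I₂) + (L²/8) ν̂(4) (1 − 2 I₂^⊥)`. -/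
theorem B_formula (ν : Measure circle2) (hprob : IsProbabilityMeasure ν)
    (hrot : ν.map mulI = ν) (hconj : ν.map conjC = ν)
    (L : ℝ) (hL : 0 < L) (γ₁ γ₂ g₁ g₂ : ℝ → ℝ)
    (hd1 : ∀ t ∈ Set.Icc (0:ℝ) L, HasDerivAt γ₁ (g₁ t) t)
    (hd2 : ∀ t ∈ Set.Icc (0:ℝ) L, HasDerivAt γ₂ (g₂ t) t)
    (hc1 : ContinuousOn g₁ (Set.Icc 0 L))
    (hc2 : ContinuousOn g₂ (Set.Icc 0 L))
    (hunit : ∀ t ∈ Set.Icc (0:ℝ) L, g₁ t ^ 2 + g₂ t ^ 2 = 1) :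
    (∫ θ : circle2, (∫ t in (0:ℝ)..L,
        ((θ : ℝ × ℝ).1 * g₁ t + (θ : ℝ × ℝ).2 * g₂ t) ^ 2) ^ 2 ∂ν) =
      L ^ 2 / 8 * (1 + 2 * ((1 / L ^ 2) * ∫ t in (0:ℝ)..L, ∫ u in (0:ℝ)..L,
          (g₁ t * g₁ u + g₂ t * g₂ u) ^ 2)) +
      L ^ 2 / 8 * (∫ θ : circle2,
          (((((θ : ℝ × ℝ).1 : ℂ) + ((θ : ℝ × ℝ).2 : ℂ) * Complex.I) ^ 4).re) ∂ν) *
        (1 - 2 * ((1 / L ^ 2) * ∫ t in (0:ℝ)..L, ∫ u in (0:ℝ)..L,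
          (g₁ t * g₂ u + g₂ t * g₁ u) ^ 2)) := by
  have quad := integral_quadratic_form hL.le hc1 hc2
  set A := ∫ t in (0 : ℝ)..L, g₁ t ^ 2
  set B := ∫ t in (0 : ℝ)..L, g₁ t * g₂ t
  set C := ∫ t in (0 : ℝ)..L, g₂ t ^ 2
  have hAC : A + C = L := by
    have h := quad 1 0 1
    have h' : ∫ t in (0 : ℝ)..L, (1 * g₁ t ^ 2 + 0 * (g₁ t * g₂ t) + 1 * g₂ t ^ 2) =
        ∫ _ in (0 : ℝ)..L, (1 : ℝ) := intervalIntegral.integral_congr fun t ht => by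
      simpa using hunit t (Set.uIcc_of_le hL.le ▸ ht)
    rw [h', intervalIntegral.integral_const, smul_eq_mul] at h
    linarith
  have hinner : ∀ x y : ℝ, ∫ t in (0 : ℝ)..L, (x * g₁ t + y * g₂ t) ^ 2 =
      x ^ 2 * A + 2 * (x * y) * B + y ^ 2 * C := fun x y => by
    rw [← quad]
    congr 1 with t
    ring
  have hI : ∫ t in (0 : ℝ)..L, ∫ u in (0 : ℝ)..L, (g₁ t * g₁ u + g₂ t * g₂ u) ^ 2 =
      A ^ 2 + 2 * B ^ 2 + C ^ 2 := by
    simp_rw [hinner]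
    rw [show A ^ 2 + 2 * B ^ 2 + C ^ 2 = A * A + 2 * B * B + C * C by ring, ← quad]
    congr 1 with t
    ring
  have hJ : ∫ t in (0 : ℝ)..L, ∫ u in (0 : ℝ)..L, (g₁ t * g₂ u + g₂ t * g₁ u) ^ 2 =
      2 * A * C + 2 * B ^ 2 := by
    simp_rw [add_comm (g₁ _ * g₂ _), hinner]
    rw [show 2 * A * C + 2 * B ^ 2 = C * A + 2 * B * B + A * C by ring, ← quad]
    congr 1 with t
    ring
  obtain ⟨hsum, hre⟩ := fourth_moments_circle2 hrot
  rw [hI, hJ]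
  simp_rw [hinner]
  rw [integral_sq_quadratic_form_circle2 hrot hconj, ← hre]
  set m := ∫ θ : circle2, (θ : ℝ × ℝ).1 ^ 4 ∂ν
  set n := ∫ θ : circle2, (θ : ℝ × ℝ).1 ^ 2 * (θ : ℝ × ℝ).2 ^ 2 ∂ν
  have hm : m = 1 / 2 - n := by linarith
  rw [hm]
  field_simp
  rw [← hAC]
  ring
end

section
/- If γ is a unit-speed continuously differentiable static curve on [0,L], then I₄ = 1/2 + 8A² − 2A + 8B². -/
open MeasureTheory

/-- For a static curve the energy `∫₀^L ⟨θ, γ'(t)⟩² dt` is `L / 2` in every direction `θ`. -/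
lemma IsStaticCurve.integral_sq_eq {L : ℝ} (hL : 0 < L) {g₁ g₂ : ℝ → ℝ}
    (h : IsStaticCurve L g₁ g₂) (a b : ℝ) (hab : a ^ 2 + b ^ 2 = 1) :
    ∫ t in (0:ℝ)..L, (a * g₁ t + b * g₂ t) ^ 2 = L / 2 := by
  have hdirac := h (Measure.dirac (⟨(a, b), hab⟩ : circle2)) inferInstance
  rw [integral_dirac] at hdirac
  have hnonneg : 0 ≤ ∫ t in (0:ℝ)..L, (a * g₁ t + b * g₂ t) ^ 2 :=
    intervalIntegral.integral_nonneg hL.le fun t _ => sq_nonneg _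
  simp only at hdirac
  refine (sq_eq_sq₀ hnonneg (by positivity)).mp ?_
  rw [hdirac]
  ring

/-- The double integral of `⟨γ'(t), γ'(u)⟩⁴` expressed through the fourth-order moments of `γ'`. -/
lemma integral_integral_inner_pow_four {L : ℝ} {g₁ g₂ : ℝ → ℝ}
    (h₁ : ContinuousOn g₁ (Set.uIcc 0 L)) (h₂ : ContinuousOn g₂ (Set.uIcc 0 L)) :
    ∫ t in (0:ℝ)..L, ∫ u in (0:ℝ)..L, (g₁ t * g₁ u + g₂ t * g₂ u) ^ 4 =
      (∫ t in (0:ℝ)..L, g₁ t ^ 4) ^ 2 + 4 * (∫ t in (0:ℝ)..L, g₁ t ^ 3 * g₂ t) ^ 2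
        + 6 * (∫ t in (0:ℝ)..L, g₁ t ^ 2 * g₂ t ^ 2) ^ 2
        + 4 * (∫ t in (0:ℝ)..L, g₁ t * g₂ t ^ 3) ^ 2 + (∫ t in (0:ℝ)..L, g₂ t ^ 4) ^ 2 := by
  have i0 : IntervalIntegrable (fun t => g₁ t ^ 4) volume 0 L :=
    ContinuousOn.intervalIntegrable (by fun_prop)
  have i1 : IntervalIntegrable (fun t => g₁ t ^ 3 * g₂ t) volume 0 L :=
    ContinuousOn.intervalIntegrable (by fun_prop)
  have i2 : IntervalIntegrable (fun t => g₁ t ^ 2 * g₂ t ^ 2) volume 0 L :=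
    ContinuousOn.intervalIntegrable (by fun_prop)
  have i3 : IntervalIntegrable (fun t => g₁ t * g₂ t ^ 3) volume 0 L :=
    ContinuousOn.intervalIntegrable (by fun_prop)
  have i4 : IntervalIntegrable (fun t => g₂ t ^ 4) volume 0 L :=
    ContinuousOn.intervalIntegrable (by fun_prop)
  have key (c₀ c₁ c₂ c₃ c₄ : ℝ) :
      ∫ t in (0:ℝ)..L, (c₀ * g₁ t ^ 4 + c₁ * (g₁ t ^ 3 * g₂ t) + c₂ * (g₁ t ^ 2 * g₂ t ^ 2)
        + c₃ * (g₁ t * g₂ t ^ 3) + c₄ * g₂ t ^ 4) =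
      c₀ * (∫ t in (0:ℝ)..L, g₁ t ^ 4) + c₁ * (∫ t in (0:ℝ)..L, g₁ t ^ 3 * g₂ t)
        + c₂ * (∫ t in (0:ℝ)..L, g₁ t ^ 2 * g₂ t ^ 2)
        + c₃ * (∫ t in (0:ℝ)..L, g₁ t * g₂ t ^ 3) + c₄ * (∫ t in (0:ℝ)..L, g₂ t ^ 4) := by
    have j0 := i0.const_mul c₀
    have j1 := i1.const_mul c₁
    have j2 := i2.const_mul c₂
    have j3 := i3.const_mul c₃
    have j4 := i4.const_mul c₄
    rw [intervalIntegral.integral_add (((j0.add j1).add j2).add j3) j4,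
      intervalIntegral.integral_add ((j0.add j1).add j2) j3,
      intervalIntegral.integral_add (j0.add j1) j2, intervalIntegral.integral_add j0 j1]
    simp only [intervalIntegral.integral_const_mul]
  have inner_eq (t : ℝ) : ∫ u in (0:ℝ)..L, (g₁ t * g₁ u + g₂ t * g₂ u) ^ 4 =
      (∫ u in (0:ℝ)..L, g₁ u ^ 4) * g₁ t ^ 4
        + (4 * ∫ u in (0:ℝ)..L, g₁ u ^ 3 * g₂ u) * (g₁ t ^ 3 * g₂ t)
        + (6 * ∫ u in (0:ℝ)..L, g₁ u ^ 2 * g₂ u ^ 2) * (g₁ t ^ 2 * g₂ t ^ 2)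
        + (4 * ∫ u in (0:ℝ)..L, g₁ u * g₂ u ^ 3) * (g₁ t * g₂ t ^ 3)
        + (∫ u in (0:ℝ)..L, g₂ u ^ 4) * g₂ t ^ 4 := by
    have hk := key (g₁ t ^ 4) (4 * (g₁ t ^ 3 * g₂ t)) (6 * (g₁ t ^ 2 * g₂ t ^ 2))
      (4 * (g₁ t * g₂ t ^ 3)) (g₂ t ^ 4)
    rw [show (fun u => (g₁ t * g₁ u + g₂ t * g₂ u) ^ 4) = fun u =>
      g₁ t ^ 4 * g₁ u ^ 4 + 4 * (g₁ t ^ 3 * g₂ t) * (g₁ u ^ 3 * g₂ u)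
        + 6 * (g₁ t ^ 2 * g₂ t ^ 2) * (g₁ u ^ 2 * g₂ u ^ 2)
        + 4 * (g₁ t * g₂ t ^ 3) * (g₁ u * g₂ u ^ 3) + g₂ t ^ 4 * g₂ u ^ 4 by
      funext u; ring, hk]
    ring
  simp only [inner_eq]
  rw [key]
  ring

/-- For a unit-speed `C¹` static curve, `I₄ = 1/2 + 8A² − 2A + 8B²`. -/
theorem I4_eq_of_static (L : ℝ) (hL : 0 < L) (γ₁ γ₂ g₁ g₂ : ℝ → ℝ)
    (hd1 : ∀ t ∈ Set.Icc (0:ℝ) L, HasDerivAt γ₁ (g₁ t) t)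
    (hd2 : ∀ t ∈ Set.Icc (0:ℝ) L, HasDerivAt γ₂ (g₂ t) t)
    (hc1 : ContinuousOn g₁ (Set.Icc 0 L))
    (hc2 : ContinuousOn g₂ (Set.Icc 0 L))
    (hunit : ∀ t ∈ Set.Icc (0:ℝ) L, g₁ t ^ 2 + g₂ t ^ 2 = 1)
    (hstatic : IsStaticCurve L g₁ g₂) :
    (1 / L ^ 2) * (∫ t in (0:ℝ)..L, ∫ u in (0:ℝ)..L,
        (g₁ t * g₁ u + g₂ t * g₂ u) ^ 4) =
      1 / 2 + 8 * ((1 / L) * ∫ t in (0:ℝ)..L, g₁ t ^ 2 * g₂ t ^ 2) ^ 2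
        - 2 * ((1 / L) * ∫ t in (0:ℝ)..L, g₁ t ^ 2 * g₂ t ^ 2)
        + 8 * ((1 / L) * ∫ t in (0:ℝ)..L, g₁ t ^ 3 * g₂ t) ^ 2 := by
  have hc1' : ContinuousOn g₁ (Set.uIcc 0 L) := by rwa [Set.uIcc_of_le hL.le]
  have hc2' : ContinuousOn g₂ (Set.uIcc 0 L) := by rwa [Set.uIcc_of_le hL.le]
  have hunit' : ∀ t ∈ Set.uIcc 0 L, g₁ t ^ 2 + g₂ t ^ 2 = 1 := by
    rwa [Set.uIcc_of_le hL.le]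
  have i11 : IntervalIntegrable (fun t => g₁ t ^ 2) volume 0 L :=
    ContinuousOn.intervalIntegrable (by fun_prop)
  have i12 : IntervalIntegrable (fun t => g₁ t * g₂ t) volume 0 L :=
    ContinuousOn.intervalIntegrable (by fun_prop)
  have i22 : IntervalIntegrable (fun t => g₂ t ^ 2) volume 0 L :=
    ContinuousOn.intervalIntegrable (by fun_prop)
  have i1112 : IntervalIntegrable (fun t => g₁ t ^ 3 * g₂ t) volume 0 L :=
    ContinuousOn.intervalIntegrable (by fun_prop)
  have i1122 : IntervalIntegrable (fun t => g₁ t ^ 2 * g₂ t ^ 2) volume 0 L :=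
    ContinuousOn.intervalIntegrable (by fun_prop)
  have s11 : ∫ t in (0:ℝ)..L, g₁ t ^ 2 = L / 2 := by
    simpa using hstatic.integral_sq_eq hL 1 0 (by norm_num)
  have s22 : ∫ t in (0:ℝ)..L, g₂ t ^ 2 = L / 2 := by
    simpa using hstatic.integral_sq_eq hL 0 1 (by norm_num)
  have s12 : ∫ t in (0:ℝ)..L, g₁ t * g₂ t = 0 := by
    have h := hstatic.integral_sq_eq hL (3 / 5) (4 / 5) (by norm_num)
    rw [show (fun t => (3 / 5 * g₁ t + 4 / 5 * g₂ t) ^ 2) = fun t =>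
        9 / 25 * g₁ t ^ 2 + 24 / 25 * (g₁ t * g₂ t) + 16 / 25 * g₂ t ^ 2 by funext t; ring,
      intervalIntegral.integral_add ((i11.const_mul _).add (i12.const_mul _)) (i22.const_mul _),
      intervalIntegral.integral_add (i11.const_mul _) (i12.const_mul _)] at h
    simp only [intervalIntegral.integral_const_mul, s11, s22] at h
    linarith
  have s1111 : ∫ t in (0:ℝ)..L, g₁ t ^ 4 = L / 2 - ∫ t in (0:ℝ)..L, g₁ t ^ 2 * g₂ t ^ 2 := by
    rw [← s11, ← intervalIntegral.integral_sub i11 i1122]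
    refine intervalIntegral.integral_congr fun t ht => ?_
    linear_combination g₁ t ^ 2 * hunit' t ht
  have s2222 : ∫ t in (0:ℝ)..L, g₂ t ^ 4 = L / 2 - ∫ t in (0:ℝ)..L, g₁ t ^ 2 * g₂ t ^ 2 := by
    rw [← s22, ← intervalIntegral.integral_sub i22 i1122]
    refine intervalIntegral.integral_congr fun t ht => ?_
    linear_combination g₂ t ^ 2 * hunit' t ht
  have s1222 : ∫ t in (0:ℝ)..L, g₁ t * g₂ t ^ 3 = -∫ t in (0:ℝ)..L, g₁ t ^ 3 * g₂ t := by
    have h := intervalIntegral.integral_sub i12 i1112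
    rw [s12, zero_sub] at h
    rw [← h]
    refine intervalIntegral.integral_congr fun t ht => ?_
    linear_combination g₁ t * g₂ t * hunit' t ht
  rw [integral_integral_inner_pow_four hc1' hc2', s1111, s2222, s1222]
  field_simp
  ring
end

section
/- If γ is a unit-speed, twice continuously differentiable static curve on [0,L] with nowhere-zero curvature (i.e. γ''(t) ≠ 0 for every t ∈ [0,L]), then 0 < A < 1/4, B² < A(1 − 4A)/4, 3/8 ≤ I₄ < 1/2, and −1 < I₄' < 1. -/
open MeasureTheory

lemma IsStaticCurve.integral_sq {L : ℝ} (hL : 0 < L) {g₁ g₂ : ℝ → ℝ} (h : IsStaticCurve L g₁ g₂)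
    {x y : ℝ} (hxy : x ^ 2 + y ^ 2 = 1) :
    ∫ t in (0:ℝ)..L, (x * g₁ t + y * g₂ t) ^ 2 = L / 2 := by
  have key := h (Measure.dirac ⟨(x, y), hxy⟩) inferInstance
  rw [integral_dirac] at key
  have hnn : 0 ≤ ∫ t in (0:ℝ)..L, (x * g₁ t + y * g₂ t) ^ 2 :=
    intervalIntegral.integral_nonneg hL.le fun t _ => sq_nonneg _
  refine (sq_eq_sq₀ hnn (by positivity)).1 ?_
  simp only at key
  rw [key]
  ring

/-- Integral of a linear combination of the quartic monomials in two continuous functions. -/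
lemma integral_quartic_form {L : ℝ} (hL : 0 < L) {g₁ g₂ F : ℝ → ℝ}
    (hc1 : ContinuousOn g₁ (Set.Icc 0 L)) (hc2 : ContinuousOn g₂ (Set.Icc 0 L))
    (c₀ c₁ c₂ c₃ c₄ : ℝ)
    (hF : ∀ t ∈ Set.Icc (0:ℝ) L, F t = c₀ * g₁ t ^ 4 + c₁ * (g₁ t ^ 3 * g₂ t)
      + c₂ * (g₁ t ^ 2 * g₂ t ^ 2) + c₃ * (g₁ t * g₂ t ^ 3) + c₄ * g₂ t ^ 4) :
    ∫ t in (0:ℝ)..L, F t = c₀ * (∫ t in (0:ℝ)..L, g₁ t ^ 4)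
      + c₁ * (∫ t in (0:ℝ)..L, g₁ t ^ 3 * g₂ t) + c₂ * (∫ t in (0:ℝ)..L, g₁ t ^ 2 * g₂ t ^ 2)
      + c₃ * (∫ t in (0:ℝ)..L, g₁ t * g₂ t ^ 3) + c₄ * (∫ t in (0:ℝ)..L, g₂ t ^ 4) := by
  have hu : Set.uIcc 0 L = Set.Icc 0 L := Set.uIcc_of_le hL.le
  rw [← hu] at hc1 hc2 hF
  have i (c : ℝ) {f : ℝ → ℝ} (hf : ContinuousOn f (Set.uIcc 0 L)) :
      IntervalIntegrable (fun t => c * f t) volume 0 L :=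
    (continuousOn_const.mul hf).intervalIntegrable
  have i0 := i c₀ (f := fun t => g₁ t ^ 4) (by fun_prop)
  have i1 := i c₁ (f := fun t => g₁ t ^ 3 * g₂ t) (by fun_prop)
  have i2 := i c₂ (f := fun t => g₁ t ^ 2 * g₂ t ^ 2) (by fun_prop)
  have i3 := i c₃ (f := fun t => g₁ t * g₂ t ^ 3) (by fun_prop)
  have i4 := i c₄ (f := fun t => g₂ t ^ 4) (by fun_prop)
  rw [intervalIntegral.integral_congr hF,
    intervalIntegral.integral_add (((i0.add i1).add i2).add i3) i4,
    intervalIntegral.integral_add ((i0.add i1).add i2) i3,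
    intervalIntegral.integral_add (i0.add i1) i2, intervalIntegral.integral_add i0 i1]
  simp only [intervalIntegral.integral_const_mul]

/-- Where a unit vector field has nonzero derivative, no fixed nonzero linear form in its double
angle `(g₁ ^ 2 - g₂ ^ 2, 2 * g₁ * g₂)` vanishes identically. -/
lemma exists_double_angle_form_ne_zero {L : ℝ} (hL : 0 < L) {g₁ g₂ h₁ h₂ : ℝ → ℝ}
    (hdd1 : ∀ t ∈ Set.Icc (0:ℝ) L, HasDerivAt g₁ (h₁ t) t)
    (hdd2 : ∀ t ∈ Set.Icc (0:ℝ) L, HasDerivAt g₂ (h₂ t) t)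
    (hcurv : ∀ t ∈ Set.Icc (0:ℝ) L, (h₁ t, h₂ t) ≠ (0, 0))
    (hunit : ∀ t ∈ Set.Icc (0:ℝ) L, g₁ t ^ 2 + g₂ t ^ 2 = 1)
    {a b : ℝ} (hab : 0 < a ^ 2 + b ^ 2) :
    ∃ t ∈ Set.Icc (0:ℝ) L, a * (g₁ t ^ 2 - g₂ t ^ 2) + b * (2 * (g₁ t * g₂ t)) ≠ 0 := by
  by_contra! hzero
  have hm : L / 2 ∈ Set.Icc 0 L := ⟨by linarith, by linarith⟩
  have hnhds : Set.Icc 0 L ∈ nhds (L / 2) := Icc_mem_nhds (by linarith) (by linarith)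
  have d1 := hdd1 _ hm
  have d2 := hdd2 _ hm
  have hu := hunit _ hm
  have hz := hzero _ hm
  have e1 := ((d1.pow 2).add (d2.pow 2)).unique ((hasDerivAt_const (L / 2) (1:ℝ)).congr_of_eventuallyEq
    (Filter.eventually_of_mem hnhds fun t ht => by simpa using hunit t ht))
  have e2 := ((((d1.pow 2).sub (d2.pow 2)).const_mul a).add
    (((d1.mul d2).const_mul 2).const_mul b)).unique
    ((hasDerivAt_const (L / 2) (0:ℝ)).congr_of_eventuallyEq
    (Filter.eventually_of_mem hnhds fun t ht => by simpa using hzero t ht))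
  have hne := hcurv _ hm
  generalize g₁ (L / 2) = p at *
  generalize g₂ (L / 2) = q at *
  generalize h₁ (L / 2) = u at *
  generalize h₂ (L / 2) = v at *
  norm_num at e1 e2
  have e3 : p * u + q * v = 0 := by linarith
  obtain ⟨k, hk⟩ : ∃ k, k = p * v - q * u := ⟨_, rfl⟩
  have hu' : u = -(k * q) := by rw [hk]; linear_combination (-u) * hu + p * e3
  have hv' : v = k * p := by rw [hk]; linear_combination (-v) * hu + q * e3
  have hk0 : k ≠ 0 := by
    rintro rfl
    apply hne
    simp [hu', hv']
  have e4 : k * (b * (p ^ 2 - q ^ 2) - a * (2 * (p * q))) = 0 := by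
    rw [hu', hv'] at e2
    linear_combination e2 / 2
  have e5 := (mul_eq_zero.1 e4).resolve_left hk0
  have : a ^ 2 + b ^ 2 = 0 := by
    have : (a ^ 2 + b ^ 2) * (p ^ 2 + q ^ 2) ^ 2 = 0 := by
      linear_combination (a * (p ^ 2 - q ^ 2) + b * (2 * (p * q))) * hz
        + (b * (p ^ 2 - q ^ 2) - a * (2 * (p * q))) * e5
    simpa [hu] using this
  exact hab.ne' this

/-- For a unit-speed `C²` static curve with nowhere-zero curvature,
`0 < A < 1/4`, `B² < A(1 − 4A)/4`, `3/8 ≤ I₄ < 1/2` and `−1 < I₄' < 1`. -/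
theorem static_inequalities (L : ℝ) (hL : 0 < L) (γ₁ γ₂ g₁ g₂ h₁ h₂ : ℝ → ℝ)
    (hd1 : ∀ t ∈ Set.Icc (0:ℝ) L, HasDerivAt γ₁ (g₁ t) t)
    (hd2 : ∀ t ∈ Set.Icc (0:ℝ) L, HasDerivAt γ₂ (g₂ t) t)
    (hdd1 : ∀ t ∈ Set.Icc (0:ℝ) L, HasDerivAt g₁ (h₁ t) t)
    (hdd2 : ∀ t ∈ Set.Icc (0:ℝ) L, HasDerivAt g₂ (h₂ t) t)
    (hcc1 : ContinuousOn h₁ (Set.Icc 0 L))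
    (hcc2 : ContinuousOn h₂ (Set.Icc 0 L))
    (hcurv : ∀ t ∈ Set.Icc (0:ℝ) L, (h₁ t, h₂ t) ≠ (0, 0))
    (hunit : ∀ t ∈ Set.Icc (0:ℝ) L, g₁ t ^ 2 + g₂ t ^ 2 = 1)
    (hstatic : IsStaticCurve L g₁ g₂) :
    (0 < (1 / L) * ∫ t in (0:ℝ)..L, g₁ t ^ 2 * g₂ t ^ 2) ∧
    ((1 / L) * ∫ t in (0:ℝ)..L, g₁ t ^ 2 * g₂ t ^ 2) < 1 / 4 ∧
    ((1 / L) * ∫ t in (0:ℝ)..L, g₁ t ^ 3 * g₂ t) ^ 2 <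
      ((1 / L) * ∫ t in (0:ℝ)..L, g₁ t ^ 2 * g₂ t ^ 2) *
        (1 - 4 * ((1 / L) * ∫ t in (0:ℝ)..L, g₁ t ^ 2 * g₂ t ^ 2)) / 4 ∧
    (3 / 8 : ℝ) ≤ (1 / L ^ 2) * (∫ t in (0:ℝ)..L, ∫ u in (0:ℝ)..L,
        (g₁ t * g₁ u + g₂ t * g₂ u) ^ 4) ∧
    (1 / L ^ 2) * (∫ t in (0:ℝ)..L, ∫ u in (0:ℝ)..L,
        (g₁ t * g₁ u + g₂ t * g₂ u) ^ 4) < 1 / 2 ∧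
    (-1 : ℝ) < (1 / L) * (∫ t in (0:ℝ)..L,
        (g₁ t ^ 4 + g₂ t ^ 4 - 6 * g₁ t ^ 2 * g₂ t ^ 2)) ∧
    (1 / L) * (∫ t in (0:ℝ)..L,
        (g₁ t ^ 4 + g₂ t ^ 4 - 6 * g₁ t ^ 2 * g₂ t ^ 2)) < 1 := by
  have hc1 : ContinuousOn g₁ (Set.Icc 0 L) := fun t ht =>
    (hdd1 t ht).continuousAt.continuousWithinAt
  have hc2 : ContinuousOn g₂ (Set.Icc 0 L) := fun t ht =>
    (hdd2 t ht).continuousAt.continuousWithinAt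
  have quartic {F : ℝ → ℝ} := integral_quartic_form (F := F) hL hc1 hc2
  have s1 := hstatic.integral_sq hL (x := 1) (y := 0) (by norm_num)
  have s2 := hstatic.integral_sq hL (x := 0) (y := 1) (by norm_num)
  have s3 := hstatic.integral_sq hL (x := 3 / 5) (y := 4 / 5) (by norm_num)
  rw [quartic 1 0 1 0 0 fun t ht => by
    linear_combination (-g₁ t ^ 2) * hunit t ht] at s1
  rw [quartic 0 0 1 0 1 fun t ht => by
    linear_combination (-g₂ t ^ 2) * hunit t ht] at s2
  rw [quartic (9 / 25) (24 / 25) 1 (24 / 25) (16 / 25) fun t ht => by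
    linear_combination (-(3 / 5 * g₁ t + 4 / 5 * g₂ t) ^ 2) * hunit t ht] at s3
  have hpos (a b : ℝ) (hab : 0 < a ^ 2 + b ^ 2) :
      0 < ∫ t in (0:ℝ)..L, (a * (g₁ t ^ 2 - g₂ t ^ 2) + b * (2 * (g₁ t * g₂ t))) ^ 2 := by
    obtain ⟨c, hc, hne⟩ := exists_double_angle_form_ne_zero hL hdd1 hdd2 hcurv hunit hab
    exact intervalIntegral.integral_pos hL (by fun_prop) (fun t _ => sq_nonneg _)
      ⟨c, hc, by positivity⟩
  have hform (a b : ℝ) := quartic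
    (F := fun t => (a * (g₁ t ^ 2 - g₂ t ^ 2) + b * (2 * (g₁ t * g₂ t))) ^ 2)
    (a ^ 2) (4 * a * b) (4 * b ^ 2 - 2 * a ^ 2) (-(4 * a * b)) (a ^ 2) fun t _ => by ring
  simp only [hform] at hpos
  have hinner (t : ℝ) := quartic (F := fun u => (g₁ t * g₁ u + g₂ t * g₂ u) ^ 4)
    (g₁ t ^ 4) (4 * (g₁ t ^ 3 * g₂ t)) (6 * (g₁ t ^ 2 * g₂ t ^ 2)) (4 * (g₁ t * g₂ t ^ 3))
    (g₂ t ^ 4) fun u _ => by ring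
  have houter := quartic (F := fun t => ∫ u in (0:ℝ)..L, (g₁ t * g₁ u + g₂ t * g₂ u) ^ 4)
    (∫ t in (0:ℝ)..L, g₁ t ^ 4) (4 * ∫ t in (0:ℝ)..L, g₁ t ^ 3 * g₂ t)
    (6 * ∫ t in (0:ℝ)..L, g₁ t ^ 2 * g₂ t ^ 2) (4 * ∫ t in (0:ℝ)..L, g₁ t * g₂ t ^ 3)
    (∫ t in (0:ℝ)..L, g₂ t ^ 4) fun t _ => by rw [hinner]; ring
  rw [houter, quartic (F := fun t => g₁ t ^ 4 + g₂ t ^ 4 - 6 * g₁ t ^ 2 * g₂ t ^ 2) 1 0 (-6) 0 1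
    fun t _ => by ring]
  clear hform hinner houter quartic
  generalize (∫ t in (0:ℝ)..L, g₁ t ^ 4) = M₀ at *
  generalize (∫ t in (0:ℝ)..L, g₁ t ^ 3 * g₂ t) = M₁ at *
  generalize (∫ t in (0:ℝ)..L, g₁ t ^ 2 * g₂ t ^ 2) = M₂ at *
  generalize (∫ t in (0:ℝ)..L, g₁ t * g₂ t ^ 3) = M₃ at *
  generalize (∫ t in (0:ℝ)..L, g₂ t ^ 4) = M₄ at *
  obtain ⟨A, rfl⟩ : ∃ A, M₂ = L * A := ⟨M₂ / L, by field_simp⟩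
  obtain ⟨B, rfl⟩ : ∃ B, M₁ = L * B := ⟨M₁ / L, by field_simp⟩
  obtain rfl : M₀ = L * (1 / 2 - A) := by linarith
  obtain rfl : M₄ = L * (1 / 2 - A) := by linarith
  obtain rfl : M₃ = -(L * B) := by linarith
  have hquad (a b : ℝ) (hab : 0 < a ^ 2 + b ^ 2) :
      0 < a ^ 2 * (1 - 4 * A) + 8 * a * b * B + 4 * b ^ 2 * A := by
    refine pos_of_mul_pos_right (a := L) ?_ hL.le
    linarith [hpos a b hab]
  have hA : 0 < A := by linarith [hquad 0 1 (by norm_num)]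
  have hA' : A < 1 / 4 := by linarith [hquad 1 0 (by norm_num)]
  have hB : B ^ 2 < A * (1 - 4 * A) / 4 := by
    have : 0 < A * (A * (1 - 4 * A) - 4 * B ^ 2) := by
      linarith [hquad A (-B) (by positivity)]
    linarith [pos_of_mul_pos_right this hA.le]
  have cancel (x : ℝ) : 1 / L * (L * x) = x := by field_simp
  have hI : 1 / L ^ 2 * (L * (1 / 2 - A) * (L * (1 / 2 - A)) + 4 * (L * B) * (L * B)
      + 6 * (L * A) * (L * A) + 4 * -(L * B) * -(L * B) + L * (1 / 2 - A) * (L * (1 / 2 - A)))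
      = 2 * (1 / 2 - A) ^ 2 + 6 * A ^ 2 + 8 * B ^ 2 := by
    field_simp
    ring
  have hI' : 1 / L * (1 * (L * (1 / 2 - A)) + 0 * (L * B) + -6 * (L * A) + 0 * -(L * B)
      + 1 * (L * (1 / 2 - A))) = 1 - 8 * A := by
    field_simp
    ring
  rw [hI, hI', cancel, cancel]
  refine ⟨hA, hA', hB, ?_, ?_, by linarith, by linarith⟩
  · nlinarith [sq_nonneg (A - 1 / 8), sq_nonneg B]
  · nlinarith
end

section
/- For a unit-speed continuously differentiable curve γ on [0,L], one has I₄ = 3/8 if and only if γ is static, A = 1/8 and B = 0. Moreover, if I₄ = 3/8 then I₄' = 0. -/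
open MeasureTheory

/-- Integration of binary quartic forms in two continuous functions. -/
lemma integral_quartic_form_s4 {L : ℝ} (hL : 0 ≤ L) {p q : ℝ → ℝ}
    (hp : ContinuousOn p (Set.Icc 0 L)) (hq : ContinuousOn q (Set.Icc 0 L))
    (a b c d e : ℝ) :
    ∫ t in (0:ℝ)..L, (a * p t ^ 4 + b * (p t ^ 3 * q t) + c * (p t ^ 2 * q t ^ 2) +
        d * (p t * q t ^ 3) + e * q t ^ 4) =
      a * (∫ t in (0:ℝ)..L, p t ^ 4) + b * (∫ t in (0:ℝ)..L, p t ^ 3 * q t) +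
        c * (∫ t in (0:ℝ)..L, p t ^ 2 * q t ^ 2) + d * (∫ t in (0:ℝ)..L, p t * q t ^ 3) +
        e * (∫ t in (0:ℝ)..L, q t ^ 4) := by
  rw [← Set.uIcc_of_le hL] at hp hq
  rw [intervalIntegral.integral_add, intervalIntegral.integral_add,
    intervalIntegral.integral_add, intervalIntegral.integral_add]
  · simp only [intervalIntegral.integral_const_mul]
  all_goals exact ContinuousOn.intervalIntegrable (by fun_prop)

lemma integral_inner_pow_four {L : ℝ} (hL : 0 ≤ L) {p q : ℝ → ℝ}
    (hp : ContinuousOn p (Set.Icc 0 L)) (hq : ContinuousOn q (Set.Icc 0 L)) :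
    ∫ t in (0:ℝ)..L, ∫ u in (0:ℝ)..L, (p t * p u + q t * q u) ^ 4 =
      (∫ t in (0:ℝ)..L, p t ^ 4) ^ 2 + 4 * (∫ t in (0:ℝ)..L, p t ^ 3 * q t) ^ 2 +
        6 * (∫ t in (0:ℝ)..L, p t ^ 2 * q t ^ 2) ^ 2 +
        4 * (∫ t in (0:ℝ)..L, p t * q t ^ 3) ^ 2 + (∫ t in (0:ℝ)..L, q t ^ 4) ^ 2 := by
  have inner_eq (t : ℝ) : ∫ u in (0:ℝ)..L, (p t * p u + q t * q u) ^ 4 =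
      (∫ t in (0:ℝ)..L, p t ^ 4) * p t ^ 4 +
      (4 * ∫ t in (0:ℝ)..L, p t ^ 3 * q t) * (p t ^ 3 * q t) +
      (6 * ∫ t in (0:ℝ)..L, p t ^ 2 * q t ^ 2) * (p t ^ 2 * q t ^ 2) +
      (4 * ∫ t in (0:ℝ)..L, p t * q t ^ 3) * (p t * q t ^ 3) +
      (∫ t in (0:ℝ)..L, q t ^ 4) * q t ^ 4 := by
    have h := integral_quartic_form_s4 hL hp hq (p t ^ 4) (4 * (p t ^ 3 * q t))
      (6 * (p t ^ 2 * q t ^ 2)) (4 * (p t * q t ^ 3)) (q t ^ 4)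
    rw [show (∫ u in (0:ℝ)..L, (p t * p u + q t * q u) ^ 4) = _ from
      (intervalIntegral.integral_congr fun u _ => by ring).trans h]
    ring
  simp only [inner_eq]
  rw [integral_quartic_form_s4 hL hp hq]
  ring

/-- For a unit-speed curve, integrals of quadratic forms in the velocity reduce to quartic ones. -/
lemma integral_inner_sq {L : ℝ} (hL : 0 ≤ L) {p q : ℝ → ℝ}
    (hp : ContinuousOn p (Set.Icc 0 L)) (hq : ContinuousOn q (Set.Icc 0 L))
    (hunit : ∀ t ∈ Set.Icc (0:ℝ) L, p t ^ 2 + q t ^ 2 = 1) (x y : ℝ) :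
    ∫ t in (0:ℝ)..L, (x * p t + y * q t) ^ 2 =
      x ^ 2 * ((∫ t in (0:ℝ)..L, p t ^ 4) + ∫ t in (0:ℝ)..L, p t ^ 2 * q t ^ 2) +
      2 * x * y * ((∫ t in (0:ℝ)..L, p t ^ 3 * q t) + ∫ t in (0:ℝ)..L, p t * q t ^ 3) +
      y ^ 2 * ((∫ t in (0:ℝ)..L, p t ^ 2 * q t ^ 2) + ∫ t in (0:ℝ)..L, q t ^ 4) := by
  have h := integral_quartic_form_s4 hL hp hq (x ^ 2) (2 * x * y) (x ^ 2 + y ^ 2) (2 * x * y) (y ^ 2)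
  refine (intervalIntegral.integral_congr fun t ht => ?_).trans (h.trans (by ring))
  rw [Set.uIcc_of_le hL] at ht
  have hu := hunit t ht
  linear_combination -(x * p t + y * q t) ^ 2 * hu

lemma integral_unit_speed {L : ℝ} (hL : 0 ≤ L) {p q : ℝ → ℝ}
    (hp : ContinuousOn p (Set.Icc 0 L)) (hq : ContinuousOn q (Set.Icc 0 L))
    (hunit : ∀ t ∈ Set.Icc (0:ℝ) L, p t ^ 2 + q t ^ 2 = 1) :
    (∫ t in (0:ℝ)..L, p t ^ 4) + 2 * (∫ t in (0:ℝ)..L, p t ^ 2 * q t ^ 2) +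
      (∫ t in (0:ℝ)..L, q t ^ 4) = L := by
  have h := integral_quartic_form_s4 hL hp hq 1 0 2 0 1
  have h1 : ∫ t in (0:ℝ)..L, (1 * p t ^ 4 + 0 * (p t ^ 3 * q t) + 2 * (p t ^ 2 * q t ^ 2) +
        0 * (p t * q t ^ 3) + 1 * q t ^ 4) = ∫ _ in (0:ℝ)..L, (1:ℝ) := by
    refine intervalIntegral.integral_congr fun t ht => ?_
    rw [Set.uIcc_of_le hL] at ht
    have hu := hunit t ht
    linear_combination (p t ^ 2 + q t ^ 2 + 1) * hu
  rw [h1, intervalIntegral.integral_const] at h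
  simp only [smul_eq_mul] at h
  linarith

/-- A curve is static iff the integral of `⟨θ, γ'⟩²` is `L / 2` in every direction `θ`. -/
lemma isStaticCurve_iff {L : ℝ} (hL : 0 ≤ L) {p q : ℝ → ℝ} :
    IsStaticCurve L p q ↔ ∀ x y : ℝ, x ^ 2 + y ^ 2 = 1 →
      ∫ t in (0:ℝ)..L, (x * p t + y * q t) ^ 2 = L / 2 := by
  constructor
  · intro h x y hxy
    have hdirac := h (Measure.dirac ⟨(x, y), hxy⟩) inferInstance
    rw [integral_dirac] at hdirac
    have hnonneg : 0 ≤ ∫ t in (0:ℝ)..L, (x * p t + y * q t) ^ 2 :=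
      intervalIntegral.integral_nonneg hL fun t _ => sq_nonneg _
    refine (sq_eq_sq₀ hnonneg (by positivity)).mp ?_
    linear_combination hdirac
  · intro h ν hν
    have hconst (θ : circle2) : ∫ t in (0:ℝ)..L,
        ((θ : ℝ × ℝ).1 * p t + (θ : ℝ × ℝ).2 * q t) ^ 2 = L / 2 := h _ _ θ.2
    simp only [hconst, integral_const, probReal_univ, one_smul]
    ring

/-- `I₄ = 3/8` iff the curve is static, `A = 1/8`, `B = 0`;
moreover `I₄ = 3/8` implies `I₄' = 0`. -/
theorem doubly_static_characterization (L : ℝ) (hL : 0 < L) (γ₁ γ₂ g₁ g₂ : ℝ → ℝ)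
    (hd1 : ∀ t ∈ Set.Icc (0:ℝ) L, HasDerivAt γ₁ (g₁ t) t)
    (hd2 : ∀ t ∈ Set.Icc (0:ℝ) L, HasDerivAt γ₂ (g₂ t) t)
    (hc1 : ContinuousOn g₁ (Set.Icc 0 L))
    (hc2 : ContinuousOn g₂ (Set.Icc 0 L))
    (hunit : ∀ t ∈ Set.Icc (0:ℝ) L, g₁ t ^ 2 + g₂ t ^ 2 = 1) :
    ((1 / L ^ 2) * (∫ t in (0:ℝ)..L, ∫ u in (0:ℝ)..L,
        (g₁ t * g₁ u + g₂ t * g₂ u) ^ 4) = 3 / 8 ↔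
      (IsStaticCurve L g₁ g₂ ∧
        (1 / L) * (∫ t in (0:ℝ)..L, g₁ t ^ 2 * g₂ t ^ 2) = 1 / 8 ∧
        (1 / L) * (∫ t in (0:ℝ)..L, g₁ t ^ 3 * g₂ t) = 0)) ∧
    ((1 / L ^ 2) * (∫ t in (0:ℝ)..L, ∫ u in (0:ℝ)..L,
        (g₁ t * g₁ u + g₂ t * g₂ u) ^ 4) = 3 / 8 →
      (1 / L) * (∫ t in (0:ℝ)..L,
        (g₁ t ^ 4 + g₂ t ^ 4 - 6 * g₁ t ^ 2 * g₂ t ^ 2)) = 0) := by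
  have hI := integral_inner_pow_four hL.le hc1 hc2
  have hsq := integral_inner_sq hL.le hc1 hc2 hunit
  have hone := integral_unit_speed hL.le hc1 hc2 hunit
  have hI' : ∫ t in (0:ℝ)..L, (g₁ t ^ 4 + g₂ t ^ 4 - 6 * g₁ t ^ 2 * g₂ t ^ 2) =
      (∫ t in (0:ℝ)..L, g₁ t ^ 4) - 6 * (∫ t in (0:ℝ)..L, g₁ t ^ 2 * g₂ t ^ 2) +
        ∫ t in (0:ℝ)..L, g₂ t ^ 4 :=
    (intervalIntegral.integral_congr fun t _ => by ring).trans
      ((integral_quartic_form_s4 hL.le hc1 hc2 1 0 (-6) 0 1).trans (by ring))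
  rw [isStaticCurve_iff hL.le, hI, hI']
  simp only [hsq]
  generalize (∫ t in (0:ℝ)..L, g₁ t ^ 4) = m₄₀ at *
  generalize (∫ t in (0:ℝ)..L, g₁ t ^ 3 * g₂ t) = m₃₁ at *
  generalize (∫ t in (0:ℝ)..L, g₁ t ^ 2 * g₂ t ^ 2) = m₂₂ at *
  generalize (∫ t in (0:ℝ)..L, g₁ t * g₂ t ^ 3) = m₁₃ at *
  generalize (∫ t in (0:ℝ)..L, g₂ t ^ 4) = m₀₄ at *
  have key : (1 / L ^ 2) * (m₄₀ ^ 2 + 4 * m₃₁ ^ 2 + 6 * m₂₂ ^ 2 + 4 * m₁₃ ^ 2 + m₀₄ ^ 2) = 3 / 8 →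
      m₄₀ = m₀₄ ∧ m₃₁ = 0 ∧ m₁₃ = 0 ∧ m₂₂ = L / 8 := by
    intro h
    have hsum : (m₄₀ - m₀₄) ^ 2 / 2 + 2 * (m₃₁ + m₁₃) ^ 2 + (L - 8 * m₂₂) ^ 2 / 8 +
        2 * (m₃₁ - m₁₃) ^ 2 = 0 := by
      field_simp at h
      rw [← hone] at h ⊢
      linear_combination h / 8
    have h1 : m₄₀ - m₀₄ = 0 := by nlinarith
    have h2 : m₃₁ + m₁₃ = 0 := by nlinarith
    have h3 : L - 8 * m₂₂ = 0 := by nlinarith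
    have h4 : m₃₁ - m₁₃ = 0 := by nlinarith
    refine ⟨?_, ?_, ?_, ?_⟩ <;> linarith
  refine ⟨⟨fun h => ?_, ?_⟩, fun h => ?_⟩
  · obtain ⟨h1, h2, h3, h4⟩ := key h
    have h5 : m₀₄ = 3 * L / 8 := by linarith
    subst h1 h2 h3 h4 h5
    refine ⟨fun x y hxy => ?_, by field_simp, by simp⟩
    linear_combination L / 2 * hxy
  · rintro ⟨h, hA, hB⟩
    have h1 := h 1 0 (by norm_num)
    have h2 := h (3 / 5) (4 / 5) (by norm_num)
    have h3 : m₂₂ = L / 8 := by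
      field_simp at hA
      linarith
    have h4 : m₃₁ = 0 := by simpa [hL.ne'] using hB
    have h5 : m₄₀ = 3 * L / 8 := by linarith
    have h6 : m₀₄ = 3 * L / 8 := by linarith
    have h7 : m₁₃ = 0 := by
      rw [h3, h4, h5, h6] at h2
      linarith
    rw [h3, h4, h5, h6, h7]
    field_simp
    ring
  · obtain ⟨h1, h2, h3, h4⟩ := key h
    rw [show m₄₀ - 6 * m₂₂ + m₀₄ = 0 by linarith, mul_zero]
end

section
/- For every unit-speed continuously differentiable curve γ on [0,L], one has I₄ ≥ 3/8, with equality if and only if (1/L)∫₀^L γ₁'(t)⁴ dt = (1/L)∫₀^L γ₂'(t)⁴ dt = 3/8, (1/L)∫₀^L γ₁'(t)² γ₂'(t)² dt = 1/8, and ∫₀^L γ₁'(t)³ γ₂'(t) dt = ∫₀^L γ₁'(t) γ₂'(t)³ dt = 0. -/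
/-- The interval integral of a linear combination of five integrable functions. -/
lemma intervalIntegral_linear_comb_five {a b : ℝ} {f₁ f₂ f₃ f₄ f₅ : ℝ → ℝ}
    (h₁ : IntervalIntegrable f₁ MeasureTheory.volume a b)
    (h₂ : IntervalIntegrable f₂ MeasureTheory.volume a b)
    (h₃ : IntervalIntegrable f₃ MeasureTheory.volume a b)
    (h₄ : IntervalIntegrable f₄ MeasureTheory.volume a b)
    (h₅ : IntervalIntegrable f₅ MeasureTheory.volume a b) (c₁ c₂ c₃ c₄ c₅ : ℝ) :
    ∫ u in a..b, (c₁ * f₁ u + c₂ * f₂ u + c₃ * f₃ u + c₄ * f₄ u + c₅ * f₅ u) =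
      c₁ * (∫ u in a..b, f₁ u) + c₂ * (∫ u in a..b, f₂ u) + c₃ * (∫ u in a..b, f₃ u) +
        c₄ * (∫ u in a..b, f₄ u) + c₅ * (∫ u in a..b, f₅ u) := by
  have k₁ := h₁.const_mul c₁
  have k₂ := h₂.const_mul c₂
  have k₃ := h₃.const_mul c₃
  have k₄ := h₄.const_mul c₄
  have k₅ := h₅.const_mul c₅
  rw [intervalIntegral.integral_add (((k₁.add k₂).add k₃).add k₄) k₅,
    intervalIntegral.integral_add ((k₁.add k₂).add k₃) k₄,
    intervalIntegral.integral_add (k₁.add k₂) k₃,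
    intervalIntegral.integral_add k₁ k₂]
  simp only [intervalIntegral.integral_const_mul]

/-- For every unit-speed `C¹` curve on `[0, L]`, `I₄ ≥ 3/8`, with equality iff
`(1/L)∫ γ₁'⁴ = (1/L)∫ γ₂'⁴ = 3/8`, `(1/L)∫ γ₁'² γ₂'² = 1/8`, and
`∫ γ₁'³ γ₂' = ∫ γ₁' γ₂'³ = 0`. -/
theorem I4_ge_and_equality (L : ℝ) (hL : 0 < L) (γ₁ γ₂ g₁ g₂ : ℝ → ℝ)
    (hd1 : ∀ t ∈ Set.Icc (0:ℝ) L, HasDerivAt γ₁ (g₁ t) t)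
    (hd2 : ∀ t ∈ Set.Icc (0:ℝ) L, HasDerivAt γ₂ (g₂ t) t)
    (hc1 : ContinuousOn g₁ (Set.Icc 0 L))
    (hc2 : ContinuousOn g₂ (Set.Icc 0 L))
    (hunit : ∀ t ∈ Set.Icc (0:ℝ) L, g₁ t ^ 2 + g₂ t ^ 2 = 1) :
    (3 / 8 : ℝ) ≤ (1 / L ^ 2) * (∫ t in (0:ℝ)..L, ∫ u in (0:ℝ)..L,
        (g₁ t * g₁ u + g₂ t * g₂ u) ^ 4) ∧
    ((1 / L ^ 2) * (∫ t in (0:ℝ)..L, ∫ u in (0:ℝ)..L,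
        (g₁ t * g₁ u + g₂ t * g₂ u) ^ 4) = 3 / 8 ↔
      ((1 / L) * (∫ t in (0:ℝ)..L, g₁ t ^ 4) = 3 / 8 ∧
       (1 / L) * (∫ t in (0:ℝ)..L, g₂ t ^ 4) = 3 / 8 ∧
       (1 / L) * (∫ t in (0:ℝ)..L, g₁ t ^ 2 * g₂ t ^ 2) = 1 / 8 ∧
       (∫ t in (0:ℝ)..L, g₁ t ^ 3 * g₂ t) = 0 ∧
       (∫ t in (0:ℝ)..L, g₁ t * g₂ t ^ 3) = 0)) := by
  have hint : ∀ f : ℝ → ℝ, ContinuousOn f (Set.Icc 0 L) →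
      IntervalIntegrable f MeasureTheory.volume 0 L :=
    fun f hf => hf.intervalIntegrable_of_Icc hL.le
  have i₁ := hint (fun t => g₁ t ^ 4) (by fun_prop)
  have i₂ := hint (fun t => g₂ t ^ 4) (by fun_prop)
  have i₃ := hint (fun t => g₁ t ^ 2 * g₂ t ^ 2) (by fun_prop)
  have i₄ := hint (fun t => g₁ t ^ 3 * g₂ t) (by fun_prop)
  have i₅ := hint (fun t => g₁ t * g₂ t ^ 3) (by fun_prop)
  have hcomb := intervalIntegral_linear_comb_five i₁ i₂ i₃ i₄ i₅
  set A := ∫ t in (0:ℝ)..L, g₁ t ^ 4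
  set B := ∫ t in (0:ℝ)..L, g₂ t ^ 4
  set C := ∫ t in (0:ℝ)..L, g₁ t ^ 2 * g₂ t ^ 2
  set D := ∫ t in (0:ℝ)..L, g₁ t ^ 3 * g₂ t
  set E := ∫ t in (0:ℝ)..L, g₁ t * g₂ t ^ 3
  have htotal : A + B + 2 * C = L := by
    have h : (∫ t in (0:ℝ)..L, (1 * g₁ t ^ 4 + 1 * g₂ t ^ 4 + 2 * (g₁ t ^ 2 * g₂ t ^ 2) +
        0 * (g₁ t ^ 3 * g₂ t) + 0 * (g₁ t * g₂ t ^ 3))) = ∫ _ in (0:ℝ)..L, (1:ℝ) := by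
      refine intervalIntegral.integral_congr fun t ht => ?_
      rw [Set.uIcc_of_le hL.le] at ht
      linear_combination (g₁ t ^ 2 + g₂ t ^ 2 + 1) * hunit t ht
    rw [hcomb, intervalIntegral.integral_const, smul_eq_mul] at h
    linarith
  have hinner : ∀ t, (∫ u in (0:ℝ)..L, (g₁ t * g₁ u + g₂ t * g₂ u) ^ 4) =
      A * g₁ t ^ 4 + B * g₂ t ^ 4 + (6 * C) * (g₁ t ^ 2 * g₂ t ^ 2) +
        (4 * D) * (g₁ t ^ 3 * g₂ t) + (4 * E) * (g₁ t * g₂ t ^ 3) := by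
    intro t
    have h := hcomb (g₁ t ^ 4) (g₂ t ^ 4) (6 * (g₁ t ^ 2 * g₂ t ^ 2))
      (4 * (g₁ t ^ 3 * g₂ t)) (4 * (g₁ t * g₂ t ^ 3))
    calc _ = _ := intervalIntegral.integral_congr fun u _ => by ring
      _ = _ := h
      _ = _ := by ring
  have hI : (1 / L ^ 2) * (∫ t in (0:ℝ)..L, ∫ u in (0:ℝ)..L,
      (g₁ t * g₁ u + g₂ t * g₂ u) ^ 4) = 3 / 8 + ((1 / L * A - 3 / 8) ^ 2 +
        (1 / L * B - 3 / 8) ^ 2 + 6 * (1 / L * C - 1 / 8) ^ 2 +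
        4 * (1 / L * D) ^ 2 + 4 * (1 / L * E) ^ 2) := by
    simp only [hinner]
    rw [hcomb]
    field_simp
    linear_combination (48 * L) * htotal
  rw [hI]
  refine ⟨le_add_of_nonneg_right (by positivity), fun h => ?_, ?_⟩
  · have hA := sq_nonneg (1 / L * A - 3 / 8)
    have hB := sq_nonneg (1 / L * B - 3 / 8)
    have hC := sq_nonneg (1 / L * C - 1 / 8)
    have hD := sq_nonneg (1 / L * D)
    have hE := sq_nonneg (1 / L * E)
    have hL' : 1 / L ≠ 0 := (one_div_pos.mpr hL).ne'
    exact ⟨sub_eq_zero.mp (pow_eq_zero_iff two_ne_zero |>.mp (by linarith)),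
      sub_eq_zero.mp (pow_eq_zero_iff two_ne_zero |>.mp (by linarith)),
      sub_eq_zero.mp (pow_eq_zero_iff two_ne_zero |>.mp (by linarith)),
      (mul_eq_zero.mp (pow_eq_zero_iff two_ne_zero |>.mp (by linarith))).resolve_left hL',
      (mul_eq_zero.mp (pow_eq_zero_iff two_ne_zero |>.mp (by linarith))).resolve_left hL'⟩
  · rintro ⟨hA, hB, hC, hD, hE⟩
    rw [hA, hB, hC, hD, hE]
    norm_num
end

section
/- Let k be an integer with k = 3 or k ≥ 5, let L > 0, and let γ : ℝ → ℝ² be a continuously differentiable unit-speed curve such that γ'(t + L/k) = R_{2π/k} γ'(t) for all t ∈ ℝ, where R_{2π/k} is the rotation of ℝ² by angle 2π/k. Then I₄ := (1/L²)∫₀^L∫₀^L ⟨γ'(t),γ'(u)⟩⁴ dt du = 3/8, i.e. the curve is doubly static. -/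
open Real

/-- Counterclockwise rotation of `ℝ²` by angle `θ`. -/
noncomputable def rot (θ : ℝ) (p : ℝ × ℝ) : ℝ × ℝ :=
  (Real.cos θ * p.1 - Real.sin θ * p.2, Real.sin θ * p.1 + Real.cos θ * p.2)

/-- A function which is multiplied by a `k`-th root of unity `c ≠ 1` under translation
by `L / k` has integral zero over `[0, L]`. -/
theorem intervalIntegral_eq_zero_of_translate_eq_mul {f : ℝ → ℂ} {k : ℕ}
    (hk : k ≠ 0) {L : ℝ} {c : ℂ} (hck : c ^ k = 1) (hc : c ≠ 1)
    (h : ∀ t, f (t + L / k) = c * f t) : ∫ t in (0 : ℝ)..L, f t = 0 := by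
  have hiter : ∀ (n : ℕ) (t : ℝ), f (t + n * (L / k)) = c ^ n * f t := by
    intro n
    induction n with
    | zero => simp
    | succ n ih =>
      intro t
      rw [show t + ((n + 1 : ℕ) : ℝ) * (L / k) = t + n * (L / k) + L / k by push_cast; ring,
        h, ih]
      ring
  have hper : Function.Periodic f L := by
    intro t
    have := hiter k t
    rwa [mul_div_cancel₀ _ (Nat.cast_ne_zero.mpr hk), hck, one_mul] at this
  have hshift : ∫ t in (0 : ℝ)..L, f (t + L / k) = ∫ t in (0 : ℝ)..L, f t := by
    rw [intervalIntegral.integral_comp_add_right, zero_add, add_comm L,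
      hper.intervalIntegral_add_eq (L / k) 0, zero_add]
  simp only [h, intervalIntegral.integral_const_mul] at hshift
  have hmul : (c - 1) * ∫ t in (0 : ℝ)..L, f t = 0 := by rw [sub_mul, hshift]; ring
  exact (mul_eq_zero.mp hmul).resolve_left (sub_ne_zero.mpr hc)

/-- The fourth power of the inner product of two unit vectors of the plane, as a trigonometric
polynomial in the angle between them. -/
theorem inner_pow_four_eq_re {a b x y : ℝ} (hab : a ^ 2 + b ^ 2 = 1) (hxy : x ^ 2 + y ^ 2 = 1) :
    (a * x + b * y) ^ 4 = 3 / 8 +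
      ((1 / 2 * (⟨a, -b⟩ : ℂ) ^ 2 * (⟨x, y⟩ : ℂ) ^ 2).re +
        (1 / 8 * (⟨a, -b⟩ : ℂ) ^ 4 * (⟨x, y⟩ : ℂ) ^ 4).re) := by
  obtain ⟨p, hp⟩ : ∃ p, p = a * x + b * y := ⟨_, rfl⟩
  obtain ⟨q, hq⟩ : ∃ q, q = a * y - b * x := ⟨_, rfl⟩
  have hpq : q ^ 2 = 1 - p ^ 2 := by
    rw [hp, hq]
    linear_combination (x ^ 2 + y ^ 2) * hab + hxy
  have hprod : (⟨a, -b⟩ : ℂ) * ⟨x, y⟩ = ⟨p, q⟩ := by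
    apply Complex.ext
    · simp [hp]
    · simp [hq]; ring
  have h2 : ((⟨p, q⟩ : ℂ) ^ 2).re = p ^ 2 - q ^ 2 := by simp [pow_succ]
  have h4 : ((⟨p, q⟩ : ℂ) ^ 4).re = p ^ 4 - 6 * p ^ 2 * q ^ 2 + q ^ 4 := by
    simp [pow_succ]; ring
  rw [mul_assoc, mul_assoc, ← mul_pow, ← mul_pow, hprod,
    show (1 / 2 : ℂ) = ((1 / 2 : ℝ) : ℂ) by norm_num,
    show (1 / 8 : ℂ) = ((1 / 8 : ℝ) : ℂ) by norm_num,
    Complex.re_ofReal_mul, Complex.re_ofReal_mul, h2, h4, ← hp,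
    show q ^ 4 = (q ^ 2) ^ 2 by ring, hpq]
  ring

/-- A unit-speed `C¹` curve `γ : ℝ → ℝ²` whose tangent satisfies
`γ'(t + L/k) = R_{2π/k} γ'(t)` for all `t`, with `k = 3` or `k ≥ 5`, is doubly static:
`I₄ = (1/L²)∫₀^L∫₀^L ⟨γ'(t),γ'(u)⟩⁴ dt du = 3/8`. -/
theorem rotation_invariant_doubly_static (k : ℕ) (hk : k = 3 ∨ 5 ≤ k)
    (L : ℝ) (hL : 0 < L) (γ₁ γ₂ g₁ g₂ : ℝ → ℝ)
    (hd1 : ∀ t : ℝ, HasDerivAt γ₁ (g₁ t) t)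
    (hd2 : ∀ t : ℝ, HasDerivAt γ₂ (g₂ t) t)
    (hc1 : Continuous g₁) (hc2 : Continuous g₂)
    (hunit : ∀ t : ℝ, g₁ t ^ 2 + g₂ t ^ 2 = 1)
    (hsym : ∀ t : ℝ, (g₁ (t + L / k), g₂ (t + L / k)) = rot (2 * π / k) (g₁ t, g₂ t)) :
    (1 / L ^ 2) * (∫ t in (0:ℝ)..L, ∫ u in (0:ℝ)..L,
        (g₁ t * g₁ u + g₂ t * g₂ u) ^ 4) = 3 / 8 := by
  have hk0 : k ≠ 0 := by omega
  let z : ℝ → ℂ := fun t => ⟨g₁ t, g₂ t⟩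
  have hz : Continuous z := by
    have : z = fun t => (g₁ t : ℂ) + g₂ t * Complex.I :=
      funext fun t => Complex.mk_eq_add_mul_I _ _
    rw [this]
    fun_prop
  let ζ : ℂ := Complex.exp (2 * π * Complex.I / k)
  have hζ : IsPrimitiveRoot ζ k := Complex.isPrimitiveRoot_exp k hk0
  have hζ_eq : ζ = ⟨Real.cos (2 * π / k), Real.sin (2 * π / k)⟩ := by
    have harg : (2 * π * Complex.I / k : ℂ) = ((2 * π / k : ℝ) : ℂ) * Complex.I := by
      push_cast; ring
    change Complex.exp _ = _
    rw [harg]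
    apply Complex.ext
    · exact Complex.exp_ofReal_mul_I_re _
    · exact Complex.exp_ofReal_mul_I_im _
  have hz_rot : ∀ t, z (t + L / k) = ζ * z t := by
    intro t
    have h := Prod.ext_iff.mp (hsym t)
    simp only [rot] at h
    rw [hζ_eq]
    apply Complex.ext
    · simpa [z] using h.1
    · simpa [z, add_comm] using h.2
  have hmoment : ∀ m : ℕ, ¬ k ∣ m → ∫ u in (0 : ℝ)..L, z u ^ m = 0 := fun m hm =>
    intervalIntegral_eq_zero_of_translate_eq_mul hk0 (c := ζ ^ m)
      (by rw [← pow_mul, mul_comm, pow_mul, hζ.pow_eq_one, one_pow])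
      (fun h => hm ((hζ.pow_eq_one_iff_dvd m).mp h))
      (fun t => by rw [hz_rot, mul_pow])
  have hre : ∀ (a : ℂ) (m : ℕ), ¬ k ∣ m → ∫ u in (0 : ℝ)..L, (a * z u ^ m).re = 0 := by
    intro a m hm
    have h := Complex.reCLM.intervalIntegral_comp_comm (μ := MeasureTheory.volume)
      ((continuous_const.mul (hz.pow m)).intervalIntegrable (μ := MeasureTheory.volume) 0 L
        : IntervalIntegrable (fun u => a * z u ^ m) _ 0 L)
    simpa [intervalIntegral.integral_const_mul, hmoment m hm] using h
  have hint : ∀ (a : ℂ) (m : ℕ),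
      IntervalIntegrable (fun u => (a * z u ^ m).re) MeasureTheory.volume 0 L := fun a m =>
    (Complex.continuous_re.comp (continuous_const.mul (hz.pow m))).intervalIntegrable 0 L
  have h2 : ¬ k ∣ 2 := by
    rcases hk with rfl | hk
    · norm_num
    · exact Nat.not_dvd_of_pos_of_lt (by norm_num) (by omega)
  have h4 : ¬ k ∣ 4 := by
    rcases hk with rfl | hk
    · norm_num
    · exact Nat.not_dvd_of_pos_of_lt (by norm_num) (by omega)
  have hinner : ∀ t, ∫ u in (0 : ℝ)..L, (g₁ t * g₁ u + g₂ t * g₂ u) ^ 4 = 3 / 8 * L := by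
    intro t
    simp_rw [fun u => inner_pow_four_eq_re (hunit t) (hunit u)]
    rw [intervalIntegral.integral_add intervalIntegrable_const ((hint _ 2).add (hint _ 4)),
      intervalIntegral.integral_add (hint _ 2) (hint _ 4), hre _ 2 h2, hre _ 4 h4,
      intervalIntegral.integral_const]
    simp [mul_comm]
  simp_rw [hinner, intervalIntegral.integral_const, smul_eq_mul, sub_zero]
  field_simp
end

section
/- For every η ∈ [−1,1] and all real u₁, u₂, one has C(u₁,u₂;η)/√(V(u₁;η)·V(u₂;η)) = 1 if and only if u₁⁴ − 4u₁² = u₂⁴ − 4u₂². (This is the Full Correlation Curve characterizing resonant pairs of thresholds for boundary lengths of Arithmetic Random Waves.) -/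
/-- `a(u) := u⁴/4 − u² + 1/8`. -/
noncomputable def aFun (u : ℝ) : ℝ := u ^ 4 / 4 - u ^ 2 + 1 / 8

/-- Limiting covariance `C(u₁,u₂;η)`. -/
noncomputable def covLim (u₁ u₂ η : ℝ) : ℝ :=
  2 * aFun u₁ * aFun u₂ - (aFun u₁ + aFun u₂) / 4 + (3 + η ^ 2) / 64

/-- Limiting variance `V(u;η) = C(u,u;η)`. -/
noncomputable def varLim (u η : ℝ) : ℝ := covLim u u η

theorem covLim_eq (u₁ u₂ η : ℝ) :
    covLim u₁ u₂ η =
      2 * (u₁ ^ 4 / 4 - u₁ ^ 2) * (u₂ ^ 4 / 4 - u₂ ^ 2) + (1 + η ^ 2) / 64 := by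
  unfold covLim aFun
  ring

theorem varLim_pos (u η : ℝ) : 0 < varLim u η := by
  rw [varLim, covLim_eq]
  nlinarith [sq_nonneg (u ^ 4 / 4 - u ^ 2), sq_nonneg η]

theorem varLim_mul_varLim_sub_covLim_sq (u₁ u₂ η : ℝ) :
    varLim u₁ η * varLim u₂ η - covLim u₁ u₂ η ^ 2 =
      (1 + η ^ 2) / 32 * ((u₁ ^ 4 / 4 - u₁ ^ 2) - (u₂ ^ 4 / 4 - u₂ ^ 2)) ^ 2 := by
  simp only [varLim, covLim_eq]
  ring

/-- Full Correlation Curve: for `η ∈ [−1,1]`,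
`C(u₁,u₂;η)/√(V(u₁;η)V(u₂;η)) = 1` iff `u₁⁴ − 4u₁² = u₂⁴ − 4u₂²`. -/
theorem full_correlation_curve (η : ℝ) (hη : η ∈ Set.Icc (-1 : ℝ) 1) (u₁ u₂ : ℝ) :
    covLim u₁ u₂ η / Real.sqrt (varLim u₁ η * varLim u₂ η) = 1 ↔
      u₁ ^ 4 - 4 * u₁ ^ 2 = u₂ ^ 4 - 4 * u₂ ^ 2 := by
  have hpos : 0 < varLim u₁ η * varLim u₂ η := mul_pos (varLim_pos u₁ η) (varLim_pos u₂ η)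
  have hdet := varLim_mul_varLim_sub_covLim_sq u₁ u₂ η
  rw [div_eq_one_iff_eq (Real.sqrt_pos.2 hpos).ne']
  constructor
  · intro h
    rw [h, Real.sq_sqrt hpos.le, sub_self] at hdet
    have hk : (1 + η ^ 2) / 32 ≠ 0 := by positivity
    have hsq := (mul_eq_zero.1 hdet.symm).resolve_left hk
    linarith [pow_eq_zero_iff two_ne_zero |>.1 hsq]
  · intro h
    have hb : u₁ ^ 4 / 4 - u₁ ^ 2 = u₂ ^ 4 / 4 - u₂ ^ 2 := by linarith
    have hC : covLim u₁ u₂ η = varLim u₁ η := by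
      rw [varLim, covLim_eq, covLim_eq, hb]
    have hV : varLim u₂ η = varLim u₁ η := by
      rw [varLim, varLim, covLim_eq, covLim_eq, hb]
    rw [hC, hV, Real.sqrt_mul_self (varLim_pos u₁ η).le]
end

section
/- One has A²/5 ≤ I₄ ≤ A², and I₄ = A²/5 if and only if the fourth-moment conditions hold: ∫_Σ n_i⁴ dμ = A/5 for each i, ∫_Σ n_i² n_j² dμ = A/15 for i ≠ j, and ∫_Σ n_i n_j n_ℓ n_k dμ = 0 whenever the multi-index (i,j,ℓ,k) is neither of the form all-equal nor two pairs of equal indices; moreover I₄ = A²/5 implies ∫_Σ n_i n_j dμ = (A/3)δ_{ij} for all i,j (the surface is static). Finally, if the surface is static (I₂ = A²/3) then I₄ ≤ A²/3. -/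
open MeasureTheory

section FiniteRankKernel

variable {Ω ι κ : Type*} [MeasurableSpace Ω] {μ : Measure Ω} [Fintype ι] [Fintype κ]

theorem integral_sum_mul_const {f : ι → Ω → ℝ} (hf : ∀ p, Integrable (f p) μ) (c : ι → ℝ) :
    ∫ σ, ∑ p, f p σ * c p ∂μ = ∑ p, (∫ σ, f p σ ∂μ) * c p := by
  rw [integral_finsetSum _ fun p _ => (hf p).mul_const (c p)]
  simp only [integral_mul_const]

theorem integral_sum_const_mul {f : ι → Ω → ℝ} (hf : ∀ p, Integrable (f p) μ) (c : ι → ℝ) :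
    ∫ σ, ∑ p, c p * f p σ ∂μ = ∑ p, c p * ∫ σ, f p σ ∂μ := by
  simpa only [mul_comm] using integral_sum_mul_const hf c

theorem integral_integral_sum_mul {f : ι → Ω → ℝ} (hf : ∀ p, Integrable (f p) μ) :
    ∫ σ, ∫ σ', ∑ p, f p σ * f p σ' ∂μ ∂μ = ∑ p, (∫ σ, f p σ ∂μ) ^ 2 := by
  simp only [integral_sum_const_mul hf, integral_sum_mul_const hf, sq]

theorem integral_integral_sum_mul_mono {f : ι → Ω → ℝ} {g : κ → Ω → ℝ}
    (hf : ∀ p, Integrable (f p) μ) (hg : ∀ q, Integrable (g q) μ)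
    (h : ∀ᵐ σ ∂μ, ∀ᵐ σ' ∂μ, ∑ p, f p σ * f p σ' ≤ ∑ q, g q σ * g q σ') :
    ∫ σ, ∫ σ', ∑ p, f p σ * f p σ' ∂μ ∂μ ≤ ∫ σ, ∫ σ', ∑ q, g q σ * g q σ' ∂μ ∂μ := by
  refine integral_mono_ae ?_ ?_ ?_
  · simp only [integral_sum_const_mul hf]
    exact integrable_finsetSum _ fun p _ => (hf p).mul_const _
  · simp only [integral_sum_const_mul hg]
    exact integrable_finsetSum _ fun q _ => (hg q).mul_const _
  · filter_upwards [h] with σ hσ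
    exact integral_mono_ae (integrable_finsetSum _ fun p _ => (hf p).const_mul _)
      (integrable_finsetSum _ fun q _ => (hg q).const_mul _) hσ

end FiniteRankKernel

/-- The degree-two monomials in the coordinates of `v`. -/
def quadMonomial (v : Fin 3 → ℝ) (p : Fin 3 × Fin 3) : ℝ := v p.1 * v p.2

/-- The degree-four monomials in the coordinates of `v`. -/
def quartMonomial (v : Fin 3 → ℝ) (p : Fin 3 × Fin 3 × Fin 3 × Fin 3) : ℝ :=
  v p.1 * v p.2.1 * v p.2.2.1 * v p.2.2.2

/-- The fourth-moment tensor of the uniform measure of total mass `A` on the unit sphere. -/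
noncomputable def isotropicTensor (A : ℝ) (p : Fin 3 × Fin 3 × Fin 3 × Fin 3) : ℝ :=
  if p.1 = p.2.1 ∧ p.2.1 = p.2.2.1 ∧ p.2.2.1 = p.2.2.2 then A / 5
  else if (p.1 = p.2.1 ∧ p.2.2.1 = p.2.2.2) ∨ (p.1 = p.2.2.1 ∧ p.2.1 = p.2.2.2) ∨
      (p.1 = p.2.2.2 ∧ p.2.1 = p.2.2.1) then A / 15
  else 0

theorem inner_sq_eq_sum (v w : Fin 3 → ℝ) :
    (∑ i, v i * w i) ^ 2 = ∑ p, quadMonomial v p * quadMonomial w p := by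
  simp only [quadMonomial, Fintype.sum_prod_type, Fin.sum_univ_three]
  ring

theorem inner_pow_four_eq_sum (v w : Fin 3 → ℝ) :
    (∑ i, v i * w i) ^ 4 = ∑ p, quartMonomial v p * quartMonomial w p := by
  simp only [quartMonomial, Fintype.sum_prod_type, Fin.sum_univ_three]
  ring

theorem sum_quartMonomial_mul_isotropicTensor (v : Fin 3 → ℝ) (A : ℝ) :
    ∑ p, quartMonomial v p * isotropicTensor A p = A / 5 * (∑ i, v i ^ 2) ^ 2 := by
  simp [quartMonomial, isotropicTensor, Fintype.sum_prod_type, Fin.sum_univ_three]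
  ring

theorem sum_isotropicTensor_sq (A : ℝ) : ∑ p, isotropicTensor A p ^ 2 = A ^ 2 / 5 := by
  simp [isotropicTensor, Fintype.sum_prod_type, Fin.sum_univ_three]
  ring

theorem sum_isotropicTensor_contract (A : ℝ) (i j : Fin 3) :
    ∑ k, isotropicTensor A (i, j, k, k) = if i = j then A / 3 else 0 := by
  fin_cases i <;> fin_cases j <;> simp [isotropicTensor, Fin.sum_univ_three] <;> ring

theorem sum_quartMonomial_contract {v : Fin 3 → ℝ} (hv : ∑ i, v i ^ 2 = 1) (i j : Fin 3) :
    ∑ k, quartMonomial v (i, j, k, k) = v i * v j := by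
  simp only [quartMonomial, mul_assoc, ← Finset.mul_sum, ← sq, hv, mul_one]

theorem abs_coord_le_one {v : Fin 3 → ℝ} (hv : ∑ i, v i ^ 2 = 1) (i : Fin 3) : |v i| ≤ 1 := by
  rw [← sq_le_one_iff_abs_le_one, ← hv]
  exact Finset.single_le_sum (f := fun i => v i ^ 2) (fun _ _ => sq_nonneg _) (Finset.mem_univ i)

theorem inner_sq_le_one {v w : Fin 3 → ℝ} (hv : ∑ i, v i ^ 2 = 1) (hw : ∑ i, w i ^ 2 = 1) :
    (∑ i, v i * w i) ^ 2 ≤ 1 := by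
  simpa [hv, hw] using Finset.sum_mul_sq_le_sq_mul_sq Finset.univ v w

section UnitField

variable {Ω : Type*} [MeasurableSpace Ω] {μ : Measure Ω} [IsFiniteMeasure μ] {n : Ω → Fin 3 → ℝ}

theorem integrable_quadMonomial (hmeas : ∀ i, Measurable fun σ => n σ i)
    (hnorm : ∀ᵐ σ ∂μ, ∑ i, n σ i ^ 2 = 1) (p : Fin 3 × Fin 3) :
    Integrable (fun σ => quadMonomial (n σ) p) μ := by
  refine Integrable.of_bound ((hmeas _).mul (hmeas _)).aestronglyMeasurable 1 ?_
  filter_upwards [hnorm] with σ hσ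
  rw [quadMonomial, Real.norm_eq_abs, abs_mul]
  exact mul_le_one₀ (abs_coord_le_one hσ _) (abs_nonneg _) (abs_coord_le_one hσ _)

theorem integrable_quartMonomial (hmeas : ∀ i, Measurable fun σ => n σ i)
    (hnorm : ∀ᵐ σ ∂μ, ∑ i, n σ i ^ 2 = 1) (p : Fin 3 × Fin 3 × Fin 3 × Fin 3) :
    Integrable (fun σ => quartMonomial (n σ) p) μ := by
  refine Integrable.of_bound
    ((((hmeas _).mul (hmeas _)).mul (hmeas _)).mul (hmeas _)).aestronglyMeasurable 1 ?_
  filter_upwards [hnorm] with σ hσ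
  have h := abs_coord_le_one hσ
  rw [quartMonomial, Real.norm_eq_abs, abs_mul, abs_mul, abs_mul]
  exact mul_le_one₀ (mul_le_one₀ (mul_le_one₀ (h _) (abs_nonneg _) (h _)) (abs_nonneg _) (h _))
    (abs_nonneg _) (h _)

theorem integral_integral_inner_pow_four_eq (hmeas : ∀ i, Measurable fun σ => n σ i)
    (hnorm : ∀ᵐ σ ∂μ, ∑ i, n σ i ^ 2 = 1) :
    ∫ σ, ∫ σ', (∑ i, n σ i * n σ' i) ^ 4 ∂μ ∂μ = (μ Set.univ).toReal ^ 2 / 5 +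
      ∑ p, ((∫ σ, quartMonomial (n σ) p ∂μ) - isotropicTensor (μ Set.univ).toReal p) ^ 2 := by
  set A := (μ Set.univ).toReal with hA
  have hint := integrable_quartMonomial hmeas hnorm
  have hcross : ∑ p, (∫ σ, quartMonomial (n σ) p ∂μ) * isotropicTensor A p = A ^ 2 / 5 := by
    rw [← integral_sum_mul_const hint]
    have h : (fun σ => ∑ p, quartMonomial (n σ) p * isotropicTensor A p) =ᵐ[μ]
        fun _ => A / 5 := by
      filter_upwards [hnorm] with σ hσ
      rw [sum_quartMonomial_mul_isotropicTensor, hσ, one_pow, mul_one]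
    rw [integral_congr_ae h, integral_const, smul_eq_mul, measureReal_def, ← hA]
    ring
  simp only [inner_pow_four_eq_sum, sub_sq, Finset.sum_add_distrib, Finset.sum_sub_distrib,
    mul_assoc, ← Finset.mul_sum]
  rw [integral_integral_sum_mul hint, hcross, sum_isotropicTensor_sq]
  ring

theorem integral_integral_inner_pow_four_le (hmeas : ∀ i, Measurable fun σ => n σ i)
    (hnorm : ∀ᵐ σ ∂μ, ∑ i, n σ i ^ 2 = 1) :
    ∫ σ, ∫ σ', (∑ i, n σ i * n σ' i) ^ 4 ∂μ ∂μ ≤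
      ∫ σ, ∫ σ', (∑ i, n σ i * n σ' i) ^ 2 ∂μ ∂μ := by
  simp only [inner_pow_four_eq_sum, inner_sq_eq_sum]
  refine integral_integral_sum_mul_mono (integrable_quartMonomial hmeas hnorm)
    (integrable_quadMonomial hmeas hnorm) ?_
  filter_upwards [hnorm] with σ hσ
  filter_upwards [hnorm] with σ' hσ'
  rw [← inner_pow_four_eq_sum, ← inner_sq_eq_sum]
  nlinarith [inner_sq_le_one hσ hσ', sq_nonneg (∑ i, n σ i * n σ' i)]

theorem integral_integral_inner_sq_le (hmeas : ∀ i, Measurable fun σ => n σ i)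
    (hnorm : ∀ᵐ σ ∂μ, ∑ i, n σ i ^ 2 = 1) :
    ∫ σ, ∫ σ', (∑ i, n σ i * n σ' i) ^ 2 ∂μ ∂μ ≤ (μ Set.univ).toReal ^ 2 := by
  have h := integral_integral_sum_mul_mono (μ := μ) (g := fun (_ : Unit) _ => 1)
    (integrable_quadMonomial hmeas hnorm) (fun _ => integrable_const 1) (by
      filter_upwards [hnorm] with σ hσ
      filter_upwards [hnorm] with σ' hσ'
      simpa [← inner_sq_eq_sum] using inner_sq_le_one hσ hσ')
  simp only [inner_sq_eq_sum]
  simpa [measureReal_def, sq] using h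

theorem integral_quadMonomial_eq_of_isotropic (hmeas : ∀ i, Measurable fun σ => n σ i)
    (hnorm : ∀ᵐ σ ∂μ, ∑ i, n σ i ^ 2 = 1) {A : ℝ}
    (h : ∀ p, ∫ σ, quartMonomial (n σ) p ∂μ = isotropicTensor A p) (i j : Fin 3) :
    ∫ σ, n σ i * n σ j ∂μ = if i = j then A / 3 else 0 := by
  have hae : (fun σ => n σ i * n σ j) =ᵐ[μ] fun σ => ∑ k, quartMonomial (n σ) (i, j, k, k) := by
    filter_upwards [hnorm] with σ hσ
    rw [sum_quartMonomial_contract hσ]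
  rw [integral_congr_ae hae,
    integral_finsetSum _ fun k _ => integrable_quartMonomial hmeas hnorm (i, j, k, k)]
  simp only [h, sum_isotropicTensor_contract]

end UnitField

/-- `A²/5 ≤ I₄ ≤ A²`; `I₄ = A²/5` iff the fourth-moment conditions hold;
`I₄ = A²/5` implies staticity (`∫ nᵢnⱼ = (A/3)δᵢⱼ`); and if the surface is static
(`I₂ = A²/3`) then `I₄ ≤ A²/3`. -/
theorem surface_I4_bounds {Ω : Type*} [MeasurableSpace Ω]
    (μ : Measure Ω) [IsFiniteMeasure μ]
    (n : Ω → Fin 3 → ℝ) (hmeas : ∀ i, Measurable fun σ => n σ i)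
    (hA : 0 < (μ Set.univ).toReal)
    (hnorm : ∀ᵐ σ ∂μ, ∑ i, n σ i ^ 2 = 1) :
    ((μ Set.univ).toReal ^ 2 / 5 ≤
        ∫ σ, ∫ σ', (∑ i, n σ i * n σ' i) ^ 4 ∂μ ∂μ) ∧
    ((∫ σ, ∫ σ', (∑ i, n σ i * n σ' i) ^ 4 ∂μ ∂μ) ≤ (μ Set.univ).toReal ^ 2) ∧
    ((∫ σ, ∫ σ', (∑ i, n σ i * n σ' i) ^ 4 ∂μ ∂μ) = (μ Set.univ).toReal ^ 2 / 5 ↔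
      ∀ i j l k : Fin 3, (∫ σ, n σ i * n σ j * n σ l * n σ k ∂μ) =
        if i = j ∧ j = l ∧ l = k then (μ Set.univ).toReal / 5
        else if (i = j ∧ l = k) ∨ (i = l ∧ j = k) ∨ (i = k ∧ j = l) then
          (μ Set.univ).toReal / 15
        else 0) ∧
    ((∫ σ, ∫ σ', (∑ i, n σ i * n σ' i) ^ 4 ∂μ ∂μ) = (μ Set.univ).toReal ^ 2 / 5 →
      ∀ i j, (∫ σ, n σ i * n σ j ∂μ) =
        if i = j then (μ Set.univ).toReal / 3 else 0) ∧
    ((∫ σ, ∫ σ', (∑ i, n σ i * n σ' i) ^ 2 ∂μ ∂μ) = (μ Set.univ).toReal ^ 2 / 3 →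
      (∫ σ, ∫ σ', (∑ i, n σ i * n σ' i) ^ 4 ∂μ ∂μ) ≤ (μ Set.univ).toReal ^ 2 / 3) := by
  have hI := integral_integral_inner_pow_four_eq hmeas hnorm
  have hle := integral_integral_inner_pow_four_le hmeas hnorm
  have hiff : (∫ σ, ∫ σ', (∑ i, n σ i * n σ' i) ^ 4 ∂μ ∂μ) = (μ Set.univ).toReal ^ 2 / 5 ↔
      ∀ p, ∫ σ, quartMonomial (n σ) p ∂μ = isotropicTensor (μ Set.univ).toReal p := by
    rw [hI, add_eq_left, Finset.sum_eq_zero_iff_of_nonneg fun _ _ => sq_nonneg _]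
    simp [sub_eq_zero]
  refine ⟨?_, hle.trans (integral_integral_inner_sq_le hmeas hnorm), ?_,
    fun h => integral_quadMonomial_eq_of_isotropic hmeas hnorm (hiff.1 h), fun h => h ▸ hle⟩
  · rw [hI]
    exact le_add_of_nonneg_right (Finset.sum_nonneg fun _ _ => sq_nonneg _)
  · rw [hiff]
    exact ⟨fun h i j l k => h (i, j, l, k), fun h p => h p.1 p.2.1 p.2.2.1 p.2.2.2⟩
end

section
/- Let k ≥ 2 be an even integer. Then A²/(k+1) ≤ I_k ≤ A², and I_k = A²/(k+1) if and only if for all nonnegative integers x, y, z with x + y + z = k one has ∫_Σ n₁^x n₂^y n₃^z dμ = A·(x−1)!!·(y−1)!!·(z−1)!!/(k+1)!! if x, y, z are all even, and ∫_Σ n₁^x n₂^y n₃^z dμ = 0 otherwise; moreover I_k = A²/(k+1) implies ∫_Σ n_i n_j dμ = 0 for i ≠ j and ∫_Σ n_i² dμ = A/3 for each i (the surface is static). Finally, if I₂ = A²/3 then I_k ≤ A²/3. -/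
open MeasureTheory

namespace SurfaceMoments

/-- The solution of `a 0 = 1`, `a 1 = 0`, `a (x + 2) = (x + 1) (α + ε x) a x`. For `ε = 0` these
are the moments of a centred Gaussian of variance `α`. -/
noncomputable def twoStep (α ε : ℝ) : ℕ → ℝ
  | 0 => 1
  | 1 => 0
  | x + 2 => (x + 1) * (α + ε * x) * twoStep α ε x

/-- Binomial convolution of two sequences. -/
noncomputable def binomConv (a b : ℕ → ℝ) (k : ℕ) : ℝ :=
  ∑ p ∈ Finset.HasAntidiagonal.antidiagonal k, (k.choose p.1 : ℝ) * (a p.1 * b p.2)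

lemma binomConv_twoStep (α β ε : ℝ) (k : ℕ) :
    binomConv (twoStep α ε) (twoStep β ε) k = twoStep (α + β) ε k := by
  induction k using Nat.twoStepInduction with
  | zero => simp [binomConv, twoStep]
  | one => simp [binomConv, twoStep, Finset.Nat.antidiagonal_succ]
  | more k ih _ =>
    rw [binomConv, Finset.sum_antidiagonal_choose_succ_mul
      (fun i j => twoStep α ε i * twoStep β ε j) (k + 1),
      Finset.Nat.sum_antidiagonal_succ', Finset.Nat.sum_antidiagonal_succ]
    simp only [twoStep, mul_zero, zero_mul, zero_add]
    rw [← ih, binomConv, ← Finset.sum_add_distrib, Finset.mul_sum]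
    refine Finset.sum_congr rfl fun p hp => ?_
    obtain ⟨x, y⟩ := p
    obtain rfl : x + y = k := by simpa using hp
    have h₁ : ((x + y).choose x : ℝ) * (x + y + 1) = ((x + y + 1).choose x : ℝ) * (y + 1) := by
      have h := Nat.choose_mul_succ_eq (x + y) x
      rw [show x + y + 1 - x = y + 1 by omega] at h
      exact_mod_cast h
    have h₂ : ((x + y).choose x : ℝ) * (x + y + 1) = ((x + y + 1).choose y : ℝ) * (x + 1) := by
      have h := Nat.choose_mul_succ_eq (x + y) y
      rw [show x + y + 1 - y = x + 1 by omega, ← Nat.choose_symm_add] at h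
      exact_mod_cast h
    push_cast
    linear_combination -(β + ε * y) * twoStep α ε x * twoStep β ε y * h₁
      - (α + ε * x) * twoStep α ε x * twoStep β ε y * h₂

/-- The index set of triples `(x, y, z)` with `x + y + z = k`, stored as `⟨(x, y + z), (y, z)⟩`. -/
def triples (k : ℕ) : Finset (Σ _ : ℕ × ℕ, ℕ × ℕ) :=
  (Finset.HasAntidiagonal.antidiagonal k).sigma fun p => Finset.HasAntidiagonal.antidiagonal p.2

/-- The trinomial coefficient attached to `⟨(x, y + z), (y, z)⟩`. -/
noncomputable def trinom (k : ℕ) (p : Σ _ : ℕ × ℕ, ℕ × ℕ) : ℝ :=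
  (k.choose p.1.1 : ℝ) * (p.1.2.choose p.2.1 : ℝ)

lemma add_eq_of_mem_triples {k : ℕ} {p : Σ _ : ℕ × ℕ, ℕ × ℕ} (hp : p ∈ triples k) :
    p.1.1 + p.2.1 + p.2.2 = k := by
  simp only [triples, Finset.mem_sigma, Finset.HasAntidiagonal.mem_antidiagonal] at hp
  omega

lemma mem_triples (x y z : ℕ) :
    (⟨(x, y + z), (y, z)⟩ : Σ _ : ℕ × ℕ, ℕ × ℕ) ∈ triples (x + y + z) := by
  simp [triples, add_assoc]

lemma trinom_pos {k : ℕ} {p : Σ _ : ℕ × ℕ, ℕ × ℕ} (hp : p ∈ triples k) : 0 < trinom k p := by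
  simp only [triples, Finset.mem_sigma, Finset.HasAntidiagonal.mem_antidiagonal] at hp
  have h₁ := Nat.choose_pos (show p.1.1 ≤ k by omega)
  have h₂ := Nat.choose_pos (show p.2.1 ≤ p.1.2 by omega)
  unfold trinom
  positivity

lemma sum_trinom (a b c : ℕ → ℝ) (k : ℕ) :
    ∑ p ∈ triples k, trinom k p * (a p.1.1 * b p.2.1 * c p.2.2) =
      binomConv a (binomConv b c) k := by
  rw [triples, Finset.sum_sigma, binomConv]
  refine Finset.sum_congr rfl fun p _ => ?_
  rw [binomConv, Finset.mul_sum, Finset.mul_sum]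
  refine Finset.sum_congr rfl fun q _ => ?_
  simp only [trinom]
  ring

lemma binomConv_pow (a b : ℝ) : binomConv (a ^ ·) (b ^ ·) = ((a + b) ^ ·) := by
  funext k
  simp [binomConv, (Commute.all a b).add_pow', nsmul_eq_mul]

lemma sum_trinom_twoStep (α β γ ε : ℝ) (k : ℕ) :
    ∑ p ∈ triples k, trinom k p *
      (twoStep α ε p.1.1 * twoStep β ε p.2.1 * twoStep γ ε p.2.2) =
      twoStep (α + β + γ) ε k := by
  rw [sum_trinom, funext (binomConv_twoStep β γ ε), binomConv_twoStep, add_assoc]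

/-- The moments of the standard Gaussian. -/
noncomputable def gaussMoment (x : ℕ) : ℝ :=
  if Even x then (Nat.doubleFactorial (x - 1) : ℝ) else 0

lemma gaussMoment_add_two (x : ℕ) : gaussMoment (x + 2) = (x + 1) * gaussMoment x := by
  unfold gaussMoment
  rcases x with _ | x
  · simp
  · by_cases h : Even (x + 1)
    · rw [if_pos h, if_pos (h.add even_two), show x + 1 + 2 - 1 = x + 2 by omega,
        Nat.doubleFactorial_add_two]
      push_cast
      ring
    · rw [if_neg h, if_neg (by simpa [Nat.even_add] using h), mul_zero]

lemma gaussMoment_mul_pow (u : ℝ) (x : ℕ) : gaussMoment x * u ^ x = twoStep (u ^ 2) 0 x := by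
  induction x using Nat.twoStepInduction with
  | zero => simp [gaussMoment, twoStep]
  | one => simp [gaussMoment, twoStep]
  | more x ih _ =>
    rw [gaussMoment_add_two, twoStep, ← ih]
    ring

lemma gaussMoment_sq (x : ℕ) : gaussMoment x ^ 2 = twoStep 1 1 x := by
  induction x using Nat.twoStepInduction with
  | zero => simp [gaussMoment, twoStep]
  | one => simp [gaussMoment, twoStep]
  | more x ih _ =>
    rw [gaussMoment_add_two, twoStep, ← ih]
    ring

lemma twoStep_three_one (x : ℕ) :
    twoStep 3 1 x = (Nat.doubleFactorial (x + 1) : ℝ) * gaussMoment x := by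
  induction x using Nat.twoStepInduction with
  | zero => simp [gaussMoment, twoStep]
  | one => simp [gaussMoment, twoStep]
  | more x ih _ =>
    rw [gaussMoment_add_two, twoStep, ih, Nat.doubleFactorial_add_two (x + 1)]
    push_cast
    ring

/-- The average of `u₀ ^ x * u₁ ^ y * u₂ ^ z` over the unit sphere. -/
noncomputable def sphereMoment (x y z : ℕ) : ℝ :=
  gaussMoment x * gaussMoment y * gaussMoment z / Nat.doubleFactorial (x + y + z + 1)

lemma sphereMoment_eq_ite (A : ℝ) (x y z : ℕ) :
    A * sphereMoment x y z =
      if Even x ∧ Even y ∧ Even z then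
        A * ((Nat.doubleFactorial (x - 1) * Nat.doubleFactorial (y - 1) *
          Nat.doubleFactorial (z - 1) : ℕ) : ℝ) / ((Nat.doubleFactorial (x + y + z + 1) : ℕ) : ℝ)
      else 0 := by
  unfold sphereMoment gaussMoment
  by_cases hx : Even x <;> by_cases hy : Even y <;> by_cases hz : Even z <;>
    simp [hx, hy, hz, mul_div_assoc]

lemma sphereMoment_contract (x y z : ℕ) :
    sphereMoment (x + 2) y z + sphereMoment x (y + 2) z + sphereMoment x y (z + 2) =
      sphereMoment x y z := by
  unfold sphereMoment
  have hpos : (0 : ℝ) < Nat.doubleFactorial (x + y + z + 1) := by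
    exact_mod_cast Nat.doubleFactorial_pos _
  rw [show x + 2 + y + z + 1 = x + y + z + 1 + 2 by ring,
    show x + (y + 2) + z + 1 = x + y + z + 1 + 2 by ring,
    show x + y + (z + 2) + 1 = x + y + z + 1 + 2 by ring, Nat.doubleFactorial_add_two]
  simp only [gaussMoment_add_two]
  push_cast
  field_simp
  ring

lemma gaussMoment_div_doubleFactorial {k : ℕ} (hk : Even k) :
    gaussMoment k / (Nat.doubleFactorial (k + 1) : ℝ) = 1 / (k + 1) := by
  have h : (Nat.doubleFactorial (k + 1) : ℝ) = (k + 1) * gaussMoment k := by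
    rcases k with _ | k
    · simp [gaussMoment]
    · rw [gaussMoment, if_pos hk, Nat.doubleFactorial_add_two]
      push_cast
      ring
  have hpos : (0 : ℝ) < Nat.doubleFactorial (k + 1) := by
    exact_mod_cast Nat.doubleFactorial_pos _
  rw [h] at hpos ⊢
  have : gaussMoment k ≠ 0 := fun h0 => by simp [h0] at hpos
  field_simp

/-- The monomial `v₀ ^ x * v₁ ^ y * v₂ ^ z`. -/
def monom (v : Fin 3 → ℝ) (x y z : ℕ) : ℝ := v 0 ^ x * v 1 ^ y * v 2 ^ z

lemma inner_pow_eq_sum (v w : Fin 3 → ℝ) (k : ℕ) :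
    (∑ i, v i * w i) ^ k = ∑ p ∈ triples k,
      trinom k p * monom v p.1.1 p.2.1 p.2.2 * monom w p.1.1 p.2.1 p.2.2 := by
  have h := sum_trinom ((v 0 * w 0) ^ ·) ((v 1 * w 1) ^ ·) ((v 2 * w 2) ^ ·) k
  rw [binomConv_pow, binomConv_pow] at h
  rw [Fin.sum_univ_three, add_assoc]
  refine h.symm.trans (Finset.sum_congr rfl fun p _ => ?_)
  simp only [monom]
  ring

lemma sum_trinom_sphereMoment_monom {v : Fin 3 → ℝ} (hv : ∑ i, v i ^ 2 = 1) {k : ℕ}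
    (hk : Even k) :
    ∑ p ∈ triples k, trinom k p * sphereMoment p.1.1 p.2.1 p.2.2 * monom v p.1.1 p.2.1 p.2.2 =
      1 / (k + 1) := by
  have h := sum_trinom_twoStep (v 0 ^ 2) (v 1 ^ 2) (v 2 ^ 2) 0 k
  have h1 := gaussMoment_mul_pow 1 k
  rw [← Fin.sum_univ_three (fun i => v i ^ 2), hv] at h
  rw [one_pow, one_pow, mul_one] at h1
  rw [← gaussMoment_div_doubleFactorial hk, h1, ← h, Finset.sum_div]
  refine Finset.sum_congr rfl fun p hp => ?_
  simp only [sphereMoment, monom, add_eq_of_mem_triples hp, ← gaussMoment_mul_pow]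
  ring

lemma sum_trinom_sphereMoment_sq {k : ℕ} (hk : Even k) :
    ∑ p ∈ triples k, trinom k p * sphereMoment p.1.1 p.2.1 p.2.2 ^ 2 = 1 / (k + 1) := by
  have h := sum_trinom_twoStep 1 1 1 1 k
  rw [show (1 + 1 + 1 : ℝ) = 3 by norm_num, twoStep_three_one] at h
  have hpos : (0 : ℝ) < Nat.doubleFactorial (k + 1) := by
    exact_mod_cast Nat.doubleFactorial_pos _
  rw [← gaussMoment_div_doubleFactorial hk, ← mul_div_mul_left _ _ hpos.ne', ← h, Finset.sum_div]
  refine Finset.sum_congr rfl fun p hp => ?_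
  simp only [sphereMoment, add_eq_of_mem_triples hp, ← gaussMoment_sq]
  ring

section Measure

variable {Ω : Type*} [MeasurableSpace Ω] {μ : Measure Ω} [IsFiniteMeasure μ]
  {n : Ω → Fin 3 → ℝ}

lemma abs_le_one_of_sum_sq_eq_one {v : Fin 3 → ℝ} (hv : ∑ i, v i ^ 2 = 1) (i : Fin 3) :
    |v i| ≤ 1 := by
  rw [← sq_le_one_iff_abs_le_one, ← hv]
  exact Finset.single_le_sum (f := fun i => v i ^ 2) (fun _ _ => sq_nonneg _) (Finset.mem_univ i)

lemma integrable_monom (hmeas : ∀ i, Measurable fun σ => n σ i)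
    (hnorm : ∀ᵐ σ ∂μ, ∑ i, n σ i ^ 2 = 1) (x y z : ℕ) :
    Integrable (fun σ => monom (n σ) x y z) μ := by
  refine Integrable.of_bound (C := 1) ?_ ?_
  · have h0 := hmeas 0
    have h1 := hmeas 1
    have h2 := hmeas 2
    unfold monom
    exact (((h0.pow_const x).mul (h1.pow_const y)).mul (h2.pow_const z)).aestronglyMeasurable
  · filter_upwards [hnorm] with σ hσ
    have h := fun i m => pow_le_one₀ (n := m) (abs_nonneg _) (abs_le_one_of_sum_sq_eq_one hσ i)
    rw [monom, Real.norm_eq_abs, abs_mul, abs_mul, abs_pow, abs_pow, abs_pow]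
    exact mul_le_one₀ (mul_le_one₀ (h 0 x) (by positivity) (h 1 y)) (by positivity) (h 2 z)

/-- The integral of `n₀ ^ x * n₁ ^ y * n₂ ^ z`. -/
noncomputable def moment (μ : Measure Ω) (n : Ω → Fin 3 → ℝ) (x y z : ℕ) : ℝ :=
  ∫ σ, monom (n σ) x y z ∂μ

lemma integral_inner_pow (hmeas : ∀ i, Measurable fun σ => n σ i)
    (hnorm : ∀ᵐ σ ∂μ, ∑ i, n σ i ^ 2 = 1) (k : ℕ) (v : Fin 3 → ℝ) :
    ∫ σ', (∑ i, v i * n σ' i) ^ k ∂μ = ∑ p ∈ triples k,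
      trinom k p * moment μ n p.1.1 p.2.1 p.2.2 * monom v p.1.1 p.2.1 p.2.2 := by
  simp only [inner_pow_eq_sum]
  rw [integral_finsetSum _ fun p _ => (integrable_monom hmeas hnorm _ _ _).const_mul _]
  refine Finset.sum_congr rfl fun p _ => ?_
  rw [integral_const_mul, moment]
  ring

lemma integrable_integral_inner_pow (hmeas : ∀ i, Measurable fun σ => n σ i)
    (hnorm : ∀ᵐ σ ∂μ, ∑ i, n σ i ^ 2 = 1) (k : ℕ) :
    Integrable (fun σ => ∫ σ', (∑ i, n σ i * n σ' i) ^ k ∂μ) μ := by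
  simp only [integral_inner_pow hmeas hnorm]
  exact integrable_finsetSum _ fun p _ => (integrable_monom hmeas hnorm _ _ _).const_mul _

lemma integrable_inner_pow (hmeas : ∀ i, Measurable fun σ => n σ i)
    (hnorm : ∀ᵐ σ ∂μ, ∑ i, n σ i ^ 2 = 1) (k : ℕ) (v : Fin 3 → ℝ) :
    Integrable (fun σ' => (∑ i, v i * n σ' i) ^ k) μ := by
  simp only [inner_pow_eq_sum]
  exact integrable_finsetSum _ fun p _ => (integrable_monom hmeas hnorm _ _ _).const_mul _

lemma integral_integral_inner_pow (hmeas : ∀ i, Measurable fun σ => n σ i)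
    (hnorm : ∀ᵐ σ ∂μ, ∑ i, n σ i ^ 2 = 1) (k : ℕ) :
    ∫ σ, ∫ σ', (∑ i, n σ i * n σ' i) ^ k ∂μ ∂μ =
      ∑ p ∈ triples k, trinom k p * moment μ n p.1.1 p.2.1 p.2.2 ^ 2 := by
  simp only [integral_inner_pow hmeas hnorm]
  rw [integral_finsetSum _ fun p _ => (integrable_monom hmeas hnorm _ _ _).const_mul _]
  refine Finset.sum_congr rfl fun p _ => ?_
  rw [integral_const_mul, ← moment]
  ring

lemma sum_trinom_sphereMoment_moment (hmeas : ∀ i, Measurable fun σ => n σ i)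
    (hnorm : ∀ᵐ σ ∂μ, ∑ i, n σ i ^ 2 = 1) {k : ℕ} (hk : Even k) :
    ∑ p ∈ triples k, trinom k p * sphereMoment p.1.1 p.2.1 p.2.2 * moment μ n p.1.1 p.2.1 p.2.2 =
      (μ Set.univ).toReal / (k + 1) := by
  simp only [moment, ← integral_const_mul]
  rw [← integral_finsetSum _ fun p _ => (integrable_monom hmeas hnorm _ _ _).const_mul _,
    integral_congr_ae (g := fun _ => (1 / (k + 1) : ℝ))
      (hnorm.mono fun σ hσ => sum_trinom_sphereMoment_monom hσ hk)]
  simp [Measure.real, div_eq_mul_inv]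

lemma integral_integral_inner_pow_sub (hmeas : ∀ i, Measurable fun σ => n σ i)
    (hnorm : ∀ᵐ σ ∂μ, ∑ i, n σ i ^ 2 = 1) {k : ℕ} (hk : Even k) :
    ∫ σ, ∫ σ', (∑ i, n σ i * n σ' i) ^ k ∂μ ∂μ - (μ Set.univ).toReal ^ 2 / (k + 1) =
      ∑ p ∈ triples k, trinom k p * (moment μ n p.1.1 p.2.1 p.2.2 -
        (μ Set.univ).toReal * sphereMoment p.1.1 p.2.1 p.2.2) ^ 2 := by
  have h₁ := sum_trinom_sphereMoment_moment hmeas hnorm hk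
  have h₂ := sum_trinom_sphereMoment_sq hk
  have h₃ := integral_integral_inner_pow hmeas hnorm k
  set A := (μ Set.univ).toReal
  have h : ∑ p ∈ triples k, trinom k p * (moment μ n p.1.1 p.2.1 p.2.2 -
        A * sphereMoment p.1.1 p.2.1 p.2.2) ^ 2 =
      (∑ p ∈ triples k, trinom k p * moment μ n p.1.1 p.2.1 p.2.2 ^ 2)
      - 2 * A * (∑ p ∈ triples k,
        trinom k p * sphereMoment p.1.1 p.2.1 p.2.2 * moment μ n p.1.1 p.2.1 p.2.2)
      + A ^ 2 * ∑ p ∈ triples k, trinom k p * sphereMoment p.1.1 p.2.1 p.2.2 ^ 2 := by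
    rw [Finset.mul_sum, Finset.mul_sum, ← Finset.sum_sub_distrib, ← Finset.sum_add_distrib]
    exact Finset.sum_congr rfl fun p _ => by ring
  rw [h, h₁, h₂, ← h₃]
  ring

lemma integral_integral_inner_pow_eq_iff (hmeas : ∀ i, Measurable fun σ => n σ i)
    (hnorm : ∀ᵐ σ ∂μ, ∑ i, n σ i ^ 2 = 1) {k : ℕ} (hk : Even k) :
    ∫ σ, ∫ σ', (∑ i, n σ i * n σ' i) ^ k ∂μ ∂μ = (μ Set.univ).toReal ^ 2 / (k + 1) ↔
      ∀ x y z : ℕ, x + y + z = k →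
        moment μ n x y z = (μ Set.univ).toReal * sphereMoment x y z := by
  rw [← sub_eq_zero, integral_integral_inner_pow_sub hmeas hnorm hk,
    Finset.sum_eq_zero_iff_of_nonneg fun p hp => mul_nonneg (trinom_pos hp).le (sq_nonneg _)]
  constructor
  · rintro h x y z rfl
    simpa [(trinom_pos (mem_triples x y z)).ne', sub_eq_zero] using h _ (mem_triples x y z)
  · intro h p hp
    rw [h _ _ _ (add_eq_of_mem_triples hp)]
    simp

lemma moment_contract (hmeas : ∀ i, Measurable fun σ => n σ i)
    (hnorm : ∀ᵐ σ ∂μ, ∑ i, n σ i ^ 2 = 1) (x y z : ℕ) :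
    moment μ n (x + 2) y z + moment μ n x (y + 2) z + moment μ n x y (z + 2) =
      moment μ n x y z := by
  have h := integrable_monom hmeas hnorm
  unfold moment
  rw [← integral_add (h _ _ _) (h _ _ _),
    ← integral_add (by exact (h _ _ _).add (h _ _ _)) (h _ _ _)]
  refine integral_congr_ae (hnorm.mono fun σ hσ => ?_)
  rw [Fin.sum_univ_three] at hσ
  simp only [monom]
  linear_combination n σ 0 ^ x * n σ 1 ^ y * n σ 2 ^ z * hσ

/-- Agreement with the moments of the sphere in degree `2 m + 2` descends to degree `2`. -/
lemma moment_two_eq_of_moment_eq (hmeas : ∀ i, Measurable fun σ => n σ i)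
    (hnorm : ∀ᵐ σ ∂μ, ∑ i, n σ i ^ 2 = 1) (A : ℝ) (m : ℕ)
    (h : ∀ x y z : ℕ, x + y + z = 2 * m + 2 → moment μ n x y z = A * sphereMoment x y z) :
    ∀ x y z : ℕ, x + y + z = 2 → moment μ n x y z = A * sphereMoment x y z := by
  induction m with
  | zero => exact h
  | succ m ih =>
    refine ih fun x y z hxyz => ?_
    rw [← moment_contract hmeas hnorm, ← sphereMoment_contract, h (x + 2) y z (by omega),
      h x (y + 2) z (by omega), h x y (z + 2) (by omega)]
    ring

lemma integral_integral_inner_pow_anti (hmeas : ∀ i, Measurable fun σ => n σ i)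
    (hnorm : ∀ᵐ σ ∂μ, ∑ i, n σ i ^ 2 = 1) {j k : ℕ} (hj : Even j) (hk : Even k) (hjk : j ≤ k) :
    ∫ σ, ∫ σ', (∑ i, n σ i * n σ' i) ^ k ∂μ ∂μ ≤ ∫ σ, ∫ σ', (∑ i, n σ i * n σ' i) ^ j ∂μ ∂μ := by
  refine integral_mono_ae (integrable_integral_inner_pow hmeas hnorm k)
    (integrable_integral_inner_pow hmeas hnorm j) (hnorm.mono fun σ hσ => ?_)
  refine integral_mono_ae (integrable_inner_pow hmeas hnorm k _)
    (integrable_inner_pow hmeas hnorm j _) (hnorm.mono fun σ' hσ' => ?_)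
  have h := Finset.sum_mul_sq_le_sq_mul_sq Finset.univ (n σ) (n σ')
  rw [hσ, hσ', one_mul, sq_le_one_iff_abs_le_one] at h
  simpa only [hj.pow_abs, hk.pow_abs] using pow_le_pow_of_le_one (abs_nonneg _) h hjk

end Measure

end SurfaceMoments

/-- For even `k ≥ 2`: `A²/(k+1) ≤ I_k ≤ A²`; `I_k = A²/(k+1)` iff the `k`-th moment
conditions (with double factorials) hold; `I_k = A²/(k+1)` implies staticity; and if
`I₂ = A²/3` then `I_k ≤ A²/3`. -/
theorem surface_Ik_bounds {Ω : Type*} [MeasurableSpace Ω]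
    (μ : Measure Ω) [IsFiniteMeasure μ]
    (n : Ω → Fin 3 → ℝ) (hmeas : ∀ i, Measurable fun σ => n σ i)
    (hA : 0 < (μ Set.univ).toReal)
    (hnorm : ∀ᵐ σ ∂μ, ∑ i, n σ i ^ 2 = 1)
    (k : ℕ) (hk : 2 ≤ k) (hke : Even k) :
    ((μ Set.univ).toReal ^ 2 / (k + 1) ≤
        ∫ σ, ∫ σ', (∑ i, n σ i * n σ' i) ^ k ∂μ ∂μ) ∧
    ((∫ σ, ∫ σ', (∑ i, n σ i * n σ' i) ^ k ∂μ ∂μ) ≤ (μ Set.univ).toReal ^ 2) ∧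
    ((∫ σ, ∫ σ', (∑ i, n σ i * n σ' i) ^ k ∂μ ∂μ) = (μ Set.univ).toReal ^ 2 / (k + 1) ↔
      ∀ x y z : ℕ, x + y + z = k →
        (∫ σ, n σ 0 ^ x * n σ 1 ^ y * n σ 2 ^ z ∂μ) =
          if Even x ∧ Even y ∧ Even z then
            (μ Set.univ).toReal *
              ((Nat.doubleFactorial (x - 1) * Nat.doubleFactorial (y - 1) *
                Nat.doubleFactorial (z - 1) : ℕ) : ℝ) /
              ((Nat.doubleFactorial (k + 1) : ℕ) : ℝ)
          else 0) ∧
    ((∫ σ, ∫ σ', (∑ i, n σ i * n σ' i) ^ k ∂μ ∂μ) = (μ Set.univ).toReal ^ 2 / (k + 1) →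
      (∀ i j : Fin 3, i ≠ j → (∫ σ, n σ i * n σ j ∂μ) = 0) ∧
      (∀ i : Fin 3, (∫ σ, n σ i ^ 2 ∂μ) = (μ Set.univ).toReal / 3)) ∧
    ((∫ σ, ∫ σ', (∑ i, n σ i * n σ' i) ^ 2 ∂μ ∂μ) = (μ Set.univ).toReal ^ 2 / 3 →
      (∫ σ, ∫ σ', (∑ i, n σ i * n σ' i) ^ k ∂μ ∂μ) ≤ (μ Set.univ).toReal ^ 2 / 3) := by
  have hiff := SurfaceMoments.integral_integral_inner_pow_eq_iff hmeas hnorm hke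
  refine ⟨?_, ?_, ?_, ?_, ?_⟩
  · rw [← sub_nonneg, SurfaceMoments.integral_integral_inner_pow_sub hmeas hnorm hke]
    exact Finset.sum_nonneg fun p hp =>
      mul_nonneg (SurfaceMoments.trinom_pos hp).le (sq_nonneg _)
  · refine (SurfaceMoments.integral_integral_inner_pow_anti hmeas hnorm Even.zero hke
      (Nat.zero_le k)).trans_eq ?_
    simp [Measure.real, sq]
  · rw [hiff]
    refine forall₄_congr fun x y z hxyz => ?_
    subst hxyz
    rw [SurfaceMoments.sphereMoment_eq_ite]
    rfl
  · intro h
    obtain ⟨m, rfl⟩ : ∃ m, k = 2 * m + 2 := by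
      obtain ⟨r, rfl⟩ := hke
      exact ⟨r - 1, by omega⟩
    have h₂ := SurfaceMoments.moment_two_eq_of_moment_eq hmeas hnorm _ m (hiff.1 h)
    have h200 := h₂ 2 0 0 rfl
    have h020 := h₂ 0 2 0 rfl
    have h002 := h₂ 0 0 2 rfl
    have h110 := h₂ 1 1 0 rfl
    have h101 := h₂ 1 0 1 rfl
    have h011 := h₂ 0 1 1 rfl
    simp [SurfaceMoments.moment, SurfaceMoments.monom, SurfaceMoments.sphereMoment,
      SurfaceMoments.gaussMoment, Nat.doubleFactorial] at h200 h020 h002 h110 h101 h011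
    constructor
    · intro i j hij
      have hcomm : ∀ i j, ∫ σ, n σ i * n σ j ∂μ = ∫ σ, n σ j * n σ i ∂μ := fun i j => by
        simp only [mul_comm]
      have h10 := (hcomm 1 0).trans h110
      have h20 := (hcomm 2 0).trans h101
      have h21 := (hcomm 2 1).trans h011
      fin_cases i <;> fin_cases j <;> first | exact absurd rfl hij | assumption
    · intro i
      fin_cases i <;> simp_all [div_eq_mul_inv]
  · intro h
    exact (SurfaceMoments.integral_integral_inner_pow_anti hmeas hnorm even_two hke hk).trans_eq h
end
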